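/- Let Λ be a connected Nakayama algebra with nonzero Gorenstein core. Then every simple Λ-module occurs with multiplicity exactly 1 as a composition factor of the direct sum E_1 ⊕ ⋯ ⊕ E_g of all elementary Gorenstein projective modules. -/

import Mathlib

universe u

variable (Λ : Type u) [Ring Λ]

section BasicDefs

variable (M : Type u) [AddCommGroup M] [Module Λ M]

/-- A module is uniserial if its submodules are linearly ordered by inclusion. -/
def IsUniserialMod : Prop := ∀ N N' : Submodule Λ M, N ≤ N' ∨ N' ≤ N

/-- A module is indecomposable if it is nonzero and admits no nontrivial direct sum
decomposition. -/
def IsIndecomposableMod : Prop :=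
  Nontrivial M ∧ ∀ N N' : Submodule Λ M, IsCompl N N' → N = ⊥ ∨ N' = ⊥

/-- The radical of a module: the intersection of all maximal submodules. -/
def modRadical : Submodule Λ M := sInf {N : Submodule Λ M | IsCoatom N}

/-- The socle of a module: the sum of all simple submodules. -/
def modSocle : Submodule Λ M := sSup {N : Submodule Λ M | IsAtom N}

/-- `HasLength Λ M n` : the module `M` has a composition series of length `n`. -/
def HasLength (n : ℕ) : Prop :=
  ∃ c : Fin (n + 1) → Submodule Λ M,
    c 0 = ⊥ ∧ c (Fin.last n) = ⊤ ∧ ∀ i : Fin n, c i.castSucc ⋖ c i.succ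

end BasicDefs

/-- A Nakayama algebra: an artinian ring all of whose finite-length indecomposable
(left) modules are uniserial. -/
class IsNakayama : Prop where
  artinian : IsArtinianRing Λ
  serial : ∀ (M : Type u) [AddCommGroup M] [Module Λ M],
    (∃ n, HasLength Λ M n) → IsIndecomposableMod Λ M → IsUniserialMod Λ M

/-- `Λ` has no simple projective module. -/
def NoSimpleProjectives : Prop :=
  ∀ (M : Type u) [AddCommGroup M] [Module Λ M], IsSimpleModule Λ M → ¬ Module.Projective Λ M

/-- `Λ` is connected: no nontrivial central idempotents. -/
def IsConnectedAlg : Prop :=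
  ∀ e : Λ, IsIdempotentElem e → (∀ x : Λ, e * x = x * e) → e = 0 ∨ e = 1

section Covers

variable {Λ}
variable {P M : Type u} [AddCommGroup P] [Module Λ P] [AddCommGroup M] [Module Λ M]

/-- `p : P → M` is a projective cover: `P` projective, `p` surjective with superfluous
kernel. -/
structure IsProjCover (p : P →ₗ[Λ] M) : Prop where
  projective : Module.Projective Λ P
  surjective : Function.Surjective p
  superfluous : LinearMap.ker p ≤ modRadical Λ P

end Covers

/-- `S` is (isomorphic to) the top `M/rad M` of `M`, and is simple. -/
def IsTopOf (S M : Type u) [AddCommGroup S] [Module Λ S] [AddCommGroup M] [Module Λ M] :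
    Prop :=
  IsSimpleModule Λ S ∧
    ∃ p : M →ₗ[Λ] S, Function.Surjective p ∧ LinearMap.ker p = modRadical Λ M

/-- `S` is (isomorphic to) the socle of `M`. -/
def IsSocleOf (S M : Type u) [AddCommGroup S] [Module Λ S] [AddCommGroup M] [Module Λ M] :
    Prop :=
  ∃ i : S →ₗ[Λ] M, Function.Injective i ∧ LinearMap.range i = modSocle Λ M

/-- `IsTauOf Λ T S` : `T` is the Auslander–Reiten translate `τ S` of the simple module `S`;
for a Nakayama algebra without simple projectives this means there is a length-2 module
with top `S` and socle `T`. -/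
def IsTauOf (T S : Type u) [AddCommGroup T] [Module Λ T] [AddCommGroup S] [Module Λ S] :
    Prop :=
  IsSimpleModule Λ S ∧ IsSimpleModule Λ T ∧
    ∃ L : ModuleCat.{u} Λ, HasLength Λ L 2 ∧ IsTopOf Λ S L ∧ IsSocleOf Λ T L

/-- `GammaRel Λ S T` : `T = γ S = τ soc P(S)` in the resolution quiver. -/
def GammaRel (S T : Type u) [AddCommGroup S] [Module Λ S] [AddCommGroup T] [Module Λ T] :
    Prop :=
  IsSimpleModule Λ S ∧
    ∃ (P : ModuleCat.{u} Λ) (p : P →ₗ[Λ] S), IsProjCover p ∧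
      ∃ V : ModuleCat.{u} Λ, IsSimpleModule Λ V ∧ IsSocleOf Λ V P ∧ IsTauOf Λ T V

/-- A simple module is black if its projective dimension is at least 2, i.e. the kernel of
its projective cover is not projective. -/
def IsBlackSimple (S : Type u) [AddCommGroup S] [Module Λ S] : Prop :=
  IsSimpleModule Λ S ∧
    ∀ (P : ModuleCat.{u} Λ) (p : P →ₗ[Λ] S), IsProjCover p →
      ¬ Module.Projective Λ (LinearMap.ker p)

/-- A simple module is red if it has projective dimension exactly 1, i.e. the kernel of its
projective cover is projective. -/
def IsRedSimple (S : Type u) [AddCommGroup S] [Module Λ S] : Prop :=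
  IsSimpleModule Λ S ∧
    ∃ (P : ModuleCat.{u} Λ) (p : P →ₗ[Λ] S), IsProjCover p ∧
      Module.Projective Λ (LinearMap.ker p)

/-- A simple module is cyclically black if it lies on a cycle of the resolution quiver all
of whose vertices are black. -/
def IsCyclicallyBlack (S : Type u) [AddCommGroup S] [Module Λ S] : Prop :=
  ∃ (n : ℕ) (C : ℕ → ModuleCat.{u} Λ), 0 < n ∧
    Nonempty ((C 0 : Type u) ≃ₗ[Λ] S) ∧ Nonempty ((C n : Type u) ≃ₗ[Λ] S) ∧
    (∀ i < n, GammaRel Λ (C i) (C (i + 1))) ∧ ∀ i ≤ n, IsBlackSimple Λ (C i)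

/-- An indecomposable projective module is minimal projective if its radical is not
projective. -/
def IsMinimalProjective (P : Type u) [AddCommGroup P] [Module Λ P] : Prop :=
  Module.Projective Λ P ∧ IsIndecomposableMod Λ P ∧
    ¬ Module.Projective Λ (modRadical Λ P)

/-- `M` is Gorenstein projective: it is an image in a complete projective resolution, i.e.
an exact complex of projectives which stays exact after applying `Hom(-, Λ)`. -/
def IsGorensteinProjective (M : Type u) [AddCommGroup M] [Module Λ M] : Prop :=
  ∃ (P : ℤ → ModuleCat.{u} Λ) (d : ∀ i, P (i + 1) →ₗ[Λ] P i),
    (∀ i, Module.Projective Λ (P i)) ∧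
    (∀ i, Function.Exact (d (i + 1)) (d i)) ∧
    (∀ (i : ℤ) (φ : P (i + 1) →ₗ[Λ] Λ), φ.comp (d (i + 1)) = 0 →
      ∃ ψ : P i →ₗ[Λ] Λ, ψ.comp (d i) = φ) ∧
    Nonempty (M ≃ₗ[Λ] LinearMap.range (d 0))

/-- `M` has a finite projective resolution. -/
def HasFinitePD (M : Type u) [AddCommGroup M] [Module Λ M] : Prop :=
  ∃ (n : ℕ) (P : ℕ → ModuleCat.{u} Λ) (d : ∀ i, P (i + 1) →ₗ[Λ] P i)
      (ε : P 0 →ₗ[Λ] M),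
    (∀ i, Module.Projective Λ (P i)) ∧ Function.Surjective ε ∧
    Function.Exact (d 0) ε ∧ (∀ i, Function.Exact (d (i + 1)) (d i)) ∧
    ∀ i, n < i → Subsingleton (P i)

/-- `M` has injective dimension at most `n` (over the ring `Λ`). -/
def InjDimLE (M : Type u) [AddCommGroup M] [Module Λ M] (n : ℕ) : Prop :=
  ∃ (I : ℕ → ModuleCat.{u} Λ) (η : M →ₗ[Λ] I 0) (d : ∀ i, I i →ₗ[Λ] I (i + 1)),
    (∀ i, Module.Injective Λ (I i)) ∧ Function.Injective η ∧
    Function.Exact η (d 0) ∧ (∀ i, Function.Exact (d i) (d (i + 1))) ∧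
    ∀ i, n < i → Subsingleton (I i)

/-- `Λ` is a Gorenstein algebra: finite injective dimension as a left and right module
over itself. -/
def IsGorensteinAlg : Prop :=
  (∃ n, InjDimLE Λ Λ n) ∧ ∃ n, InjDimLE Λᵐᵒᵖ Λ n

/-- Every cycle of the resolution quiver consists of black vertices. -/
def AllCyclesBlack : Prop :=
  ∀ (n : ℕ) (C : ℕ → ModuleCat.{u} Λ), 0 < n →
    (∀ i < n, GammaRel Λ (C i) (C (i + 1))) →
    Nonempty ((C n : Type u) ≃ₗ[Λ] (C 0 : Type u)) →
    ∀ i ≤ n, IsBlackSimple Λ (C i)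

/-- Every cycle of the resolution quiver contains a red vertex. -/
def EveryCycleHasRed : Prop :=
  ∀ (n : ℕ) (C : ℕ → ModuleCat.{u} Λ), 0 < n →
    (∀ i < n, GammaRel Λ (C i) (C (i + 1))) →
    Nonempty ((C n : Type u) ≃ₗ[Λ] (C 0 : Type u)) →
    ∃ i ≤ n, IsRedSimple Λ (C i)

/-- `Λ` is CM-free: every finite-length Gorenstein projective module is projective. -/
def IsCMFree : Prop :=
  ∀ (M : Type u) [AddCommGroup M] [Module Λ M],
    (∃ n, HasLength Λ M n) → IsGorensteinProjective Λ M → Module.Projective Λ M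

/-- `Λ` has exactly `s` isomorphism classes of simple modules. -/
def SimpleCount (s : ℕ) : Prop :=
  ∃ F : Fin s → ModuleCat.{u} Λ,
    (∀ i, IsSimpleModule Λ (F i)) ∧
    (∀ i j, i ≠ j → IsEmpty ((F i : Type u) ≃ₗ[Λ] (F j : Type u))) ∧
    ∀ (S : Type u) [AddCommGroup S] [Module Λ S], IsSimpleModule Λ S →
      ∃ i, Nonempty (S ≃ₗ[Λ] (F i : Type u))

/-- Every (finite length) indecomposable projective module has length `> s`;
this is the condition `p > s`. -/
def MinProjLengthGT (s : ℕ) : Prop :=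
  ∀ (P : Type u) [AddCommGroup P] [Module Λ P],
    Module.Projective Λ P → IsIndecomposableMod Λ P →
      ∀ n, HasLength Λ P n → s < n

/-- An elementary Gorenstein projective module: nonzero, Gorenstein projective,
non-projective, and no proper nonzero factor module is Gorenstein projective. -/
def IsElementary (E : Type u) [AddCommGroup E] [Module Λ E] : Prop :=
  Nontrivial E ∧ (∃ n, HasLength Λ E n) ∧ IsGorensteinProjective Λ E ∧
    ¬ Module.Projective Λ E ∧
    ∀ N : Submodule Λ E, N ≠ ⊥ → N ≠ ⊤ → ¬ IsGorensteinProjective Λ (E ⧸ N)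

/-- `m` is the multiplicity of the simple module `S` as a composition factor of `M`. -/
def MultiplicityOf (S M : Type u) [AddCommGroup S] [Module Λ S] [AddCommGroup M]
    [Module Λ M] (m : ℕ) : Prop :=
  ∃ (n : ℕ) (c : Fin (n + 1) → Submodule Λ M),
    c 0 = ⊥ ∧ c (Fin.last n) = ⊤ ∧ (∀ i : Fin n, c i.castSucc ⋖ c i.succ) ∧
    m = Nat.card {i : Fin n //
      Nonempty ((↥(c i.succ) ⧸ (c i.castSucc).comap (c i.succ).subtype) ≃ₗ[Λ] S)}

/-- From `S`, the cycles of the resolution quiver can be reached (in a black-cycle vertex)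
in `m` steps. -/
def ReachesBlackIn (S : Type u) [AddCommGroup S] [Module Λ S] (m : ℕ) : Prop :=
  ∃ C : ℕ → ModuleCat.{u} Λ, Nonempty ((C 0 : Type u) ≃ₗ[Λ] S) ∧
    (∀ i < m, GammaRel Λ (C i) (C (i + 1))) ∧ IsCyclicallyBlack Λ (C m)

/-- `d` is the maximal distance of a vertex of the resolution quiver to the black cycles. -/
def MaxDistToBlack (d : ℕ) : Prop :=
  (∀ (S : Type u) [AddCommGroup S] [Module Λ S], IsSimpleModule Λ S →
      ∃ m ≤ d, ReachesBlackIn Λ S m) ∧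
  ∃ S : ModuleCat.{u} Λ, IsSimpleModule Λ S ∧ ∀ m < d, ¬ ReachesBlackIn Λ (S : Type u) m

set_option linter.unusedSectionVars false
section PartA
variable {R : Type u} [Ring R]

/-- Natural number valued length of a module. -/
noncomputable def len (R : Type u) [Ring R] (M : Type u) [AddCommGroup M] [Module R M] : ℕ :=
  (Module.length R M).toNat

variable {M N X : Type u} [AddCommGroup M] [Module R M] [AddCommGroup N] [Module R N]
  [AddCommGroup X] [Module R X]

lemma len_congr (e : M ≃ₗ[R] N) : len R M = len R N := by
  rw [len, len, e.length_eq]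

lemma finite_of_hasLength (h : ∃ n, HasLength R M n) : Module.Finite R M := by
  obtain ⟨n, c, h0, h1, h2⟩ := h
  have : IsFiniteLength R M := isFiniteLength_of_exists_compositionSeries
    ⟨⟨n, c, h2⟩, h0, h1⟩
  have := (isFiniteLength_iff_isNoetherian_isArtinian.mp this).1
  infer_instance

variable [IsArtinianRing R]

lemma hasLength_of_finite [Module.Finite R M] : ∃ n, HasLength R M n := by
  have : IsArtinian R M := inferInstance
  have : IsNoetherian R M := inferInstance
  obtain ⟨s, h0, h1⟩ := exists_compositionSeries_of_isNoetherian_isArtinian R M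
  exact ⟨s.length, s.toFun, h0, h1, s.step⟩

lemma coe_len [Module.Finite R M] : (len R M : ℕ∞) = Module.length R M :=
  ENat.natCast_toNat Module.length_ne_top

lemma len_exact [Module.Finite R M] (f : N →ₗ[R] M) (g : M →ₗ[R] X)
    (hf : Function.Injective f) (hg : Function.Surjective g) (H : Function.Exact f g) :
    len R M = len R N + len R X := by
  have : Module.Finite R N := Module.Finite.of_injective f hf
  have : Module.Finite R X := Module.Finite.of_surjective g hg
  have := Module.length_eq_add_of_exact f g hf hg H
  rw [← coe_len, ← coe_len, ← coe_len] at this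
  exact_mod_cast this

lemma len_quot [Module.Finite R M] (K : Submodule R M) :
    len R K + len R (M ⧸ K) = len R M :=
  (len_exact K.subtype K.mkQ K.subtype_injective K.mkQ_surjective
    (LinearMap.exact_subtype_mkQ K)).symm

lemma len_ker_range [Module.Finite R M] (f : M →ₗ[R] N) :
    len R (LinearMap.ker f) + len R (LinearMap.range f) = len R M := by
  rw [← len_congr f.quotKerEquivRange, len_quot]

lemma len_inj [Module.Finite R N] (f : M →ₗ[R] N) (hf : Function.Injective f) :
    len R M ≤ len R N := by
  rw [len_congr (LinearEquiv.ofInjective f hf), ← len_quot (LinearMap.range f)]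
  omega

lemma len_surj [Module.Finite R M] (f : M →ₗ[R] N) (hf : Function.Surjective f) :
    len R (LinearMap.ker f) + len R N = len R M := by
  rw [← len_ker_range f, LinearMap.range_eq_top.mpr hf, len_congr Submodule.topEquiv]

lemma len_pos [Module.Finite R M] [Nontrivial M] : 0 < len R M := by
  have : 0 < Module.length R M := Module.length_pos
  rw [← coe_len] at this
  exact_mod_cast this

lemma len_eq_zero [Module.Finite R M] (h : len R M = 0) : Subsingleton M := by
  by_contra h'
  rw [not_subsingleton_iff_nontrivial] at h'
  have := len_pos (R := R) (M := M)
  omega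

lemma len_sub_le [Module.Finite R M] (K : Submodule R M) : len R K ≤ len R M := by
  rw [← len_quot K]; omega

lemma sub_bot_of_len [Module.Finite R M] {K : Submodule R M} (h : len R K = 0) : K = ⊥ := by
  have := len_eq_zero h
  exact (Submodule.subsingleton_iff_eq_bot).mp this

lemma len_bot : len R (⊥ : Submodule R M) = 0 := by
  rw [len, Module.length_bot]; rfl

lemma len_sub_pos [Module.Finite R M] {K : Submodule R M} (h : K ≠ ⊥) : 0 < len R K := by
  by_contra h'
  exact h (sub_bot_of_len (by omega))

lemma len_comap [Module.Finite R M] {K K' : Submodule R M} (h : K ≤ K') :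
    len R (K.comap K'.subtype) = len R K :=
  len_congr (Submodule.comapSubtypeEquivOfLe h)

lemma len_mono [Module.Finite R M] {K K' : Submodule R M} (h : K ≤ K') : len R K ≤ len R K' := by
  rw [← len_comap h]; exact len_sub_le _

lemma sub_top_of_len [Module.Finite R M] {K : Submodule R M} (h : len R M ≤ len R K) : K = ⊤ := by
  have := len_quot K
  have := len_eq_zero (R := R) (M := M ⧸ K) (by omega)
  exact Submodule.Quotient.subsingleton_iff.mp this

lemma sub_eq_of_len [Module.Finite R M] {K K' : Submodule R M} (h : K ≤ K')
    (hl : len R K' ≤ len R K) : K = K' := by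
  rw [← len_comap h] at hl
  have := sub_top_of_len hl
  refine le_antisymm h ?_
  rwa [Submodule.comap_subtype_eq_top] at this

lemma surj_of_inj [Module.Finite R N] (f : M →ₗ[R] N) (hf : Function.Injective f)
    (hl : len R N ≤ len R M) : Function.Surjective f := by
  rw [← LinearMap.range_eq_top]
  apply sub_top_of_len
  rwa [← len_congr (LinearEquiv.ofInjective f hf)]

lemma inj_of_surj [Module.Finite R M] (f : M →ₗ[R] N) (hf : Function.Surjective f)
    (hl : len R M ≤ len R N) : Function.Injective f := by
  rw [← LinearMap.ker_eq_bot]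
  apply sub_bot_of_len
  have := len_surj f hf
  omega

lemma len_simple (h : IsSimpleModule R M) : len R M = 1 := by
  rw [len, Module.length_eq_one]; rfl

lemma simple_of_len [Module.Finite R M] (h : len R M = 1) : IsSimpleModule R M := by
  rw [← Module.length_eq_one_iff, ← coe_len, h]; rfl

lemma exists_len [Module.Finite R M] (k : ℕ) (hk : k ≤ len R M) :
    ∃ K : Submodule R M, len R K = k := by
  obtain ⟨d, hd⟩ := Nat.exists_eq_add_of_le hk
  induction d generalizing k with
  | zero => exact ⟨⊤, by rw [len_congr Submodule.topEquiv]; omega⟩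
  | succ d ih =>
    obtain ⟨K, hK⟩ := ih (k + 1) (by omega) (by omega)
    have : Nontrivial K := by
      rw [Submodule.nontrivial_iff_ne_bot]
      rintro rfl
      rw [len_bot] at hK; omega
    obtain ⟨C, hC⟩ := IsCoatomic.exists_coatom (Submodule R K)
    have hs : IsSimpleModule R (K ⧸ C) := isSimpleModule_iff_isCoatom.mpr hC
    have h1 := len_quot C
    rw [len_simple hs, hK] at h1
    refine ⟨C.map K.subtype, ?_⟩
    rw [← len_congr (Submodule.equivMapOfInjective K.subtype K.subtype_injective C)]
    omega

/-! uniserial modules -/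

/-- nonzero finite length uniserial modules -/
structure US (R : Type u) [Ring R] (M : Type u) [AddCommGroup M] [Module R M] : Prop where
  fin : Module.Finite R M
  nt : Nontrivial M
  uni : IsUniserialMod R M

lemma US.congr (h : US R M) (e : M ≃ₗ[R] N) : US R N := by
  have := h.fin
  have := h.nt
  refine ⟨Module.Finite.equiv e, e.symm.toEquiv.nontrivial, fun A B => ?_⟩
  rcases h.uni (A.comap e.toLinearMap) (B.comap e.toLinearMap) with h | h
  · exact Or.inl ((Submodule.comap_le_comap_iff_of_surjective e.surjective).mp h)
  · exact Or.inr ((Submodule.comap_le_comap_iff_of_surjective e.surjective).mp h)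

lemma US.sub (h : US R M) {K : Submodule R M} (hK : K ≠ ⊥) : US R K := by
  have := h.fin
  refine ⟨inferInstance, Submodule.nontrivial_iff_ne_bot.mpr hK, fun A B => ?_⟩
  rcases h.uni (A.map K.subtype) (B.map K.subtype) with h | h
  · exact Or.inl ((Submodule.map_le_map_iff_of_injective K.subtype_injective _ _).mp h)
  · exact Or.inr ((Submodule.map_le_map_iff_of_injective K.subtype_injective _ _).mp h)

lemma US.of_surj (h : US R M) [Nontrivial N] (f : M →ₗ[R] N) (hf : Function.Surjective f) :
    US R N := by
  have := h.fin
  refine ⟨Module.Finite.of_surjective f hf, inferInstance, fun A B => ?_⟩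
  rcases h.uni (A.comap f) (B.comap f) with h | h
  · exact Or.inl ((Submodule.comap_le_comap_iff_of_surjective hf).mp h)
  · exact Or.inr ((Submodule.comap_le_comap_iff_of_surjective hf).mp h)

lemma US.quot (h : US R M) {K : Submodule R M} (hK : K ≠ ⊤) : US R (M ⧸ K) := by
  have : Nontrivial (M ⧸ K) := Submodule.Quotient.nontrivial_iff.mpr hK
  exact h.of_surj K.mkQ K.mkQ_surjective

lemma US.le_iff (h : US R M) {K K' : Submodule R M} : K ≤ K' ↔ len R K ≤ len R K' := by
  have := h.fin
  refine ⟨len_mono, fun hl => ?_⟩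
  rcases h.uni K K' with h1 | h1
  · exact h1
  · exact (sub_eq_of_len h1 hl).ge

lemma US.eq_of_len (h : US R M) {K K' : Submodule R M} (hl : len R K = len R K') : K = K' :=
  le_antisymm (h.le_iff.mpr hl.le) (h.le_iff.mpr hl.ge)

lemma US.simple (h : IsSimpleModule R M) : US R M := by
  refine ⟨inferInstance, IsSimpleModule.nontrivial R M, fun A B => ?_⟩
  rcases eq_bot_or_eq_top A with rfl | rfl
  · exact Or.inl bot_le
  · exact Or.inr le_top

/-- in a uniserial module two complementary submodules are trivial -/
lemma US.compl (h : US R M) {A B : Submodule R M} (hAB : A ⊓ B = ⊥) : A = ⊥ ∨ B = ⊥ := by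
  rcases h.uni A B with h1 | h1
  · left; rwa [inf_eq_left.mpr h1] at hAB
  · right; rwa [inf_eq_right.mpr h1] at hAB

lemma US.sup (h : US R M) {A B : Submodule R M} (hAB : A ⊔ B = ⊤) : A = ⊤ ∨ B = ⊤ := by
  rcases h.uni A B with h1 | h1
  · right; rwa [sup_eq_right.mpr h1] at hAB
  · left; rwa [sup_eq_left.mpr h1] at hAB

/-- A surjection from a uniserial module onto a nonzero projective module is injective. -/
lemma US.inj_of_proj (h : US R M) [Nontrivial N] (hp : Module.Projective R N) (f : M →ₗ[R] N)
    (hf : Function.Surjective f) : Function.Injective f := by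
  obtain ⟨s, hs⟩ := Module.projective_lifting_property f LinearMap.id hf
  have hs' : ∀ x, f (s x) = x := fun x => by simpa using congrArg (fun g => g x) hs
  have : LinearMap.ker f ⊓ LinearMap.range s = ⊥ := by
    rw [eq_bot_iff]
    rintro _ ⟨h1, y, rfl⟩
    have : y = 0 := by rw [← hs' y]; exact h1
    simp [this]
  rcases h.compl this with h1 | h1
  · exact LinearMap.ker_eq_bot.mp h1
  · exfalso
    obtain ⟨x, hx⟩ := exists_ne (0 : N)
    apply hx
    rw [← hs' x]
    have : s x ∈ LinearMap.range s := ⟨x, rfl⟩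
    rw [h1, Submodule.mem_bot] at this
    rw [this, map_zero]

/-- A map into a uniserial module which is onto modulo a proper submodule is onto. -/
lemma US.surj_of_comp (h : US R M) {Y : Type u} [AddCommGroup Y] [Module R Y] [Nontrivial N]
    (f : M →ₗ[R] N) (g : Y →ₗ[R] M) (hf : Function.Surjective (f ∘ₗ g)) :
    Function.Surjective g := by
  have : LinearMap.range g ⊔ LinearMap.ker f = ⊤ := by
    rw [eq_top_iff]
    rintro x -
    obtain ⟨y, hy⟩ := hf (f x)
    rw [Submodule.mem_sup]
    refine ⟨g y, ⟨y, rfl⟩, x - g y, ?_, by abel⟩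
    rw [LinearMap.mem_ker, map_sub, ← hy]; simp
  rcases h.sup this with h1 | h1
  · exact LinearMap.range_eq_top.mp h1
  · exfalso
    obtain ⟨x, hx⟩ := exists_ne (0 : N)
    obtain ⟨y, hy⟩ := hf x
    have : g y ∈ LinearMap.ker f := by rw [h1]; trivial
    exact hx (hy ▸ this)

end PartA

set_option linter.unusedSectionVars false
section PartB
variable {R : Type u} [Ring R]

instance instArtinianOfNakayama [h : IsNakayama R] : IsArtinianRing R := h.artinian

variable [IsNakayama R]
variable {M N X : Type u} [AddCommGroup M] [Module R M] [AddCommGroup N] [Module R N]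
  [AddCommGroup X] [Module R X]

lemma exists_decomp_aux (n : ℕ) : ∀ (M : Type u) [AddCommGroup M] [Module R M] [Module.Finite R M],
    len R M = n → ∃ (ι : Type) (_ : Fintype ι) (W : ι → ModuleCat.{u} R),
      (∀ i, US R (W i)) ∧ Nonempty (M ≃ₗ[R] (Π i, W i)) := by
  induction n using Nat.strong_induction_on with
  | _ n ih =>
    intro M _ _ _ hn
    rcases subsingleton_or_nontrivial M with hM | hM
    · refine ⟨Empty, inferInstance, fun i => i.elim, fun i => i.elim, ⟨?_⟩⟩
      exact LinearEquiv.ofSubsingleton _ _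
    · by_cases hind : IsIndecomposableMod R M
      · refine ⟨Unit, inferInstance, fun _ => ModuleCat.of R M,
          fun _ => ⟨inferInstance, hM, IsNakayama.serial M hasLength_of_finite hind⟩, ⟨?_⟩⟩
        exact (LinearEquiv.piUnique R (fun _ : Unit => (ModuleCat.of R M : Type u))).symm
      · have : ∃ A B : Submodule R M, IsCompl A B ∧ A ≠ ⊥ ∧ B ≠ ⊥ := by
          by_contra hcon
          push Not at hcon
          refine hind ⟨hM, fun A B hAB => ?_⟩
          by_cases hA : A = ⊥
          · exact Or.inl hA
          · exact Or.inr (hcon A B hAB hA)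
        obtain ⟨A, B, hAB, hA, hB⟩ := this
        have e := Submodule.prodEquivOfIsCompl A B hAB
        have hl : len R A + len R B = n := by
          rw [← hn, ← len_quot A, len_congr (Submodule.quotientEquivOfIsCompl A B hAB)]
        have := len_sub_pos hA
        have := len_sub_pos hB
        obtain ⟨ι1, _, W1, h1, ⟨e1⟩⟩ := ih (len R A) (by omega) A rfl
        obtain ⟨ι2, _, W2, h2, ⟨e2⟩⟩ := ih (len R B) (by omega) B rfl
        refine ⟨ι1 ⊕ ι2, inferInstance, Sum.elim W1 W2, ?_, ⟨?_⟩⟩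
        · rintro (i | i)
          · exact h1 i
          · exact h2 i
        · exact e.symm.trans ((LinearEquiv.prodCongr e1 e2).trans
            (LinearEquiv.sumPiEquivProdPi R ι1 ι2
              (fun i => ((Sum.elim W1 W2 i : ModuleCat.{u} R) : Type u))).symm)

lemma exists_decomp (M : Type u) [AddCommGroup M] [Module R M] [Module.Finite R M] :
    ∃ (ι : Type) (_ : Fintype ι) (W : ι → ModuleCat.{u} R),
      (∀ i, US R (W i)) ∧ Nonempty (M ≃ₗ[R] (Π i, W i)) :=
  exists_decomp_aux _ M rfl

lemma US.exists_min (h : US R M) : ∃ x : M, x ≠ 0 ∧ ∀ K : Submodule R M, K ≠ ⊥ → x ∈ K := by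
  have := h.fin
  have := h.nt
  obtain ⟨K, hK⟩ := exists_len (R := R) (M := M) 1 len_pos
  have hne : K ≠ ⊥ := by
    rintro rfl
    rw [len_bot] at hK; omega
  obtain ⟨x, hx, hx0⟩ := Submodule.exists_mem_ne_zero_of_ne_bot hne
  refine ⟨x, hx0, fun K' hK' => ?_⟩
  have := len_sub_pos hK'
  exact (h.le_iff (K := K) (K' := K')).mpr (by omega) hx

/-- a map out of a uniserial module which is injective on a nonzero submodule is injective -/
lemma US.inj_of_inj (h : US R M) [Nontrivial X] (α : X →ₗ[R] M) (f : M →ₗ[R] N)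
    (hα : Function.Injective (f ∘ₗ α)) : Function.Injective f := by
  have : LinearMap.ker f ⊓ LinearMap.range α = ⊥ := by
    rw [eq_bot_iff]
    rintro _ ⟨h1, y, rfl⟩
    have : y = 0 := hα (by simpa using h1)
    simp [this]
  rcases h.compl this with h1 | h1
  · exact LinearMap.ker_eq_bot.mp h1
  · exfalso
    obtain ⟨x, hx⟩ := exists_ne (0 : X)
    apply hx
    have : α x ∈ LinearMap.range α := ⟨x, rfl⟩
    rw [h1, Submodule.mem_bot] at this
    exact hα (by simp [this])

lemma pushout_aux {U W : Type u} [AddCommGroup U] [Module R U] [AddCommGroup W] [Module R W]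
    (hU : US R U) (hW : US R W) [Nontrivial X] (α : X →ₗ[R] U) (β : X →ₗ[R] W)
    (hα : Function.Injective α) (hβ : Function.Injective β) :
    ∃ (D : ModuleCat.{u} R) (a : U →ₗ[R] D) (b : W →ₗ[R] D), US R D ∧
      Function.Injective a ∧ Function.Injective b ∧ a ∘ₗ α = b ∘ₗ β := by
  have := hU.fin
  have := hW.fin
  have hX : US R X := by
    have e := LinearEquiv.ofInjective α hα
    refine (hU.sub (K := LinearMap.range α) ?_).congr e.symm
    rw [← Submodule.nontrivial_iff_ne_bot]
    exact e.symm.toEquiv.nontrivial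
  let K : Submodule R (U × W) := LinearMap.range (α.prod (-β))
  let a : U →ₗ[R] (U × W) ⧸ K := K.mkQ ∘ₗ LinearMap.inl R U W
  let b : W →ₗ[R] (U × W) ⧸ K := K.mkQ ∘ₗ LinearMap.inr R U W
  have hab : a ∘ₗ α = b ∘ₗ β := by
    ext x
    simp only [a, b, LinearMap.comp_apply, Submodule.mkQ_apply]
    rw [Submodule.Quotient.eq]
    exact ⟨x, by simp⟩
  have ha : Function.Injective a := by
    rw [← LinearMap.ker_eq_bot, eq_bot_iff]
    intro u hu
    simp only [a, LinearMap.mem_ker, LinearMap.comp_apply, Submodule.mkQ_apply] at hu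
    rw [Submodule.Quotient.mk_eq_zero] at hu
    obtain ⟨x, hx⟩ := hu
    have h1 : α x = u := by simpa using congrArg Prod.fst hx
    have h2 : β x = 0 := by simpa using congrArg Prod.snd hx
    have : x = 0 := hβ (by simp [h2])
    simp [← h1, this]
  obtain ⟨ι, _, D, hD, ⟨e⟩⟩ := exists_decomp (R := R) ((U × W) ⧸ K)
  obtain ⟨x, hx0, hx⟩ := hX.exists_min
  have : ∃ i, e (a (α x)) i ≠ 0 := by
    by_contra hcon
    push Not at hcon
    have h1 : e (a (α x)) = 0 := funext hcon
    have h2 : a (α x) = 0 := by simpa using h1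
    apply hx0
    apply hα
    apply ha
    simp [h2]
  obtain ⟨i, hi⟩ := this
  let q : ((U × W) ⧸ K) →ₗ[R] D i := LinearMap.proj i ∘ₗ e.toLinearMap
  have h1 : Function.Injective (q ∘ₗ a ∘ₗ α) := by
    rw [← LinearMap.ker_eq_bot]
    by_contra hne
    exact hi (hx _ hne)
  have h2 : Function.Injective (q ∘ₗ b ∘ₗ β) := by rwa [← hab]
  refine ⟨D i, q ∘ₗ a, q ∘ₗ b, hD i, hU.inj_of_inj α _ h1, hW.inj_of_inj β _ h2, ?_⟩
  ext y
  exact congrArg (fun g => q (g y)) hab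

lemma pushout {U W : Type u} [AddCommGroup U] [Module R U] [AddCommGroup W] [Module R W]
    (hU : US R U) (hW : US R W) [Nontrivial X] (α : X →ₗ[R] U) (β : X →ₗ[R] W)
    (hα : Function.Injective α) (hβ : Function.Injective β) (hl : len R U ≤ len R W) :
    ∃ γ : U →ₗ[R] W, Function.Injective γ ∧ γ ∘ₗ α = β := by
  obtain ⟨D, a, b, hD, ha, hb, hab⟩ := pushout_aux hU hW α β hα hβ
  have hle : LinearMap.range a ≤ LinearMap.range b := by
    rw [hD.le_iff, ← len_congr (LinearEquiv.ofInjective a ha),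
      ← len_congr (LinearEquiv.ofInjective b hb)]
    exact hl
  let eb := LinearEquiv.ofInjective b hb
  let a' : U →ₗ[R] LinearMap.range b := a.codRestrict _ (fun x => hle ⟨x, rfl⟩)
  have key : ∀ u, b (eb.symm (a' u)) = a u := by
    intro u
    have : eb (eb.symm (a' u)) = a' u := by simp
    exact congrArg Subtype.val this
  refine ⟨eb.symm.toLinearMap ∘ₗ a', ?_, ?_⟩
  · intro x y hxy
    apply ha
    rw [← key, ← key]
    exact congrArg b hxy
  · ext x
    apply hb
    simp only [LinearMap.comp_apply]
    refine (key _).trans ?_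
    exact congrArg (fun g => g x) hab

/-- extension alternative -/
lemma ext_alt {U W : Type u} [AddCommGroup U] [Module R U] [AddCommGroup W] [Module R W]
    (hU : US R U) (hW : US R W) (A : Submodule R U) (φ : A →ₗ[R] W) (hφ : φ ≠ 0) :
    (∃ ψ : U →ₗ[R] W, ψ ∘ₗ A.subtype = φ) ∨
    ∃ (K : Submodule R U) (γ : W →ₗ[R] U ⧸ K), K ≤ A ∧ ¬ A ≤ K ∧ Function.Injective γ ∧
      len R W < len R (U ⧸ K) ∧ ∀ a : A, γ (φ a) = K.mkQ a := by
  have := hU.fin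
  have := hW.fin
  let K : Submodule R U := (LinearMap.ker φ).map A.subtype
  have hKA : K ≤ A := Submodule.map_subtype_le _ _
  have hAK : ¬ A ≤ K := by
    intro h
    apply hφ
    ext a
    obtain ⟨b, hb, hba⟩ := h a.2
    have : b = a := Subtype.ext hba
    rw [← this]; exact hb
  have hKtop : K ≠ ⊤ := fun h => hAK (h ▸ le_top)
  have hUK := hU.quot hKtop
  let X := A ⧸ LinearMap.ker φ
  have : Nontrivial X := by
    rw [Submodule.Quotient.nontrivial_iff]
    intro h
    exact hφ (LinearMap.ker_eq_top.mp h)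
  let β : X →ₗ[R] W := (LinearMap.ker φ).liftQ φ le_rfl
  have hβ : Function.Injective β := by
    rw [← LinearMap.ker_eq_bot]
    exact Submodule.ker_liftQ_eq_bot _ _ _ le_rfl
  have hker : LinearMap.ker (K.mkQ ∘ₗ A.subtype) = LinearMap.ker φ := by
    rw [LinearMap.ker_comp, Submodule.ker_mkQ]
    exact Submodule.comap_map_eq_of_injective A.subtype_injective _
  let α : X →ₗ[R] U ⧸ K := (LinearMap.ker φ).liftQ (K.mkQ ∘ₗ A.subtype) hker.ge
  have hα : Function.Injective α := by
    rw [← LinearMap.ker_eq_bot]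
    exact Submodule.ker_liftQ_eq_bot _ _ _ hker.le
  by_cases hl : len R (U ⧸ K) ≤ len R W
  · left
    obtain ⟨γ, -, hγ⟩ := pushout hUK hW α β hα hβ hl
    refine ⟨γ ∘ₗ K.mkQ, ?_⟩
    ext a
    exact congrArg (fun g => g (Submodule.Quotient.mk a)) hγ
  · right
    obtain ⟨γ, hγi, hγ⟩ := pushout hW hUK β α hβ hα (by omega)
    refine ⟨K, γ, hKA, hAK, hγi, by omega, fun a => ?_⟩
    exact congrArg (fun g => g (Submodule.Quotient.mk a)) hγ

lemma exists_cover_decomp {ι : Type} [Fintype ι] (W : ι → ModuleCat.{u} R)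
    (e : R ≃ₗ[R] (Π i, W i)) (h : US R M) : ∃ (i : ι) (p : W i →ₗ[R] M), Function.Surjective p := by
  classical
  have := h.fin
  have := h.nt
  have hpos := len_pos (R := R) (M := M)
  obtain ⟨K, hK⟩ := exists_len (R := R) (M := M) (len R M - 1) (by omega)
  have hKtop : K ≠ ⊤ := by
    rintro rfl
    rw [len_congr Submodule.topEquiv] at hK; omega
  obtain ⟨x, -, hx⟩ := SetLike.exists_of_lt hKtop.lt_top
  let f : (Π i, W i) →ₗ[R] M := LinearMap.toSpanSingleton R M x ∘ₗ e.symm.toLinearMap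
  have : ∃ i, ∃ y : W i, f (Pi.single i y) ∉ K := by
    by_contra hcon
    push Not at hcon
    apply hx
    have h1 : f (e 1) = x := by simp [f]
    rw [← h1, ← Finset.univ_sum_single (e 1), map_sum]
    exact Submodule.sum_mem _ (fun i _ => hcon i _)
  obtain ⟨i, y, hy⟩ := this
  refine ⟨i, f ∘ₗ LinearMap.single R (fun i => (W i : Type u)) i, ?_⟩
  rw [← LinearMap.range_eq_top]
  have h2 : ¬ LinearMap.range (f ∘ₗ LinearMap.single R (fun i => (W i : Type u)) i) ≤ K :=
    fun h => hy (h ⟨y, rfl⟩)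
  rw [h.le_iff] at h2
  apply sub_top_of_len
  omega

lemma proj_of_decomp {ι : Type} [Fintype ι] (W : ι → ModuleCat.{u} R)
    (e : R ≃ₗ[R] (Π i, W i)) (i : ι) : Module.Projective R (W i) := by
  classical
  refine Module.Projective.of_split (e.symm.toLinearMap ∘ₗ LinearMap.single R (fun i => (W i : Type u)) i)
    (LinearMap.proj i ∘ₗ e.toLinearMap) ?_
  ext x
  simp

lemma exists_cover (h : US R M) : ∃ (P : ModuleCat.{u} R) (p : P →ₗ[R] M), US R P ∧
    Module.Projective R P ∧ Function.Surjective p := by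
  obtain ⟨ι, _, W, hW, ⟨e⟩⟩ := exists_decomp (R := R) R
  obtain ⟨i, p, hp⟩ := exists_cover_decomp W e h
  exact ⟨W i, p, hW i, proj_of_decomp W e i, hp⟩

/-- Lemma C -/
lemma proj_of_sub_proj (h : US R M) {A B : Submodule R M} (hAB : A ≤ B) (hA : A ≠ ⊥)
    (hp : Module.Projective R A) : Module.Projective R B := by
  have hB : B ≠ ⊥ := fun hB => hA (le_bot_iff.mp (hB ▸ hAB))
  obtain ⟨P, p, hP, hPp, hps⟩ := exists_cover (h.sub hB)
  let L : Submodule R P := (A.comap B.subtype).comap p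
  let q : L →ₗ[R] A := LinearMap.codRestrict A (B.subtype ∘ₗ p ∘ₗ L.subtype) (fun x => x.2)
  have hq : Function.Surjective q := by
    rintro ⟨a, ha⟩
    obtain ⟨y, hy⟩ := hps ⟨a, hAB ha⟩
    have h1 : (p y : M) = a := congrArg Subtype.val hy
    exact ⟨⟨y, by change (p y : M) ∈ A; rw [h1]; exact ha⟩, Subtype.ext h1⟩
  have hAn : Nontrivial A := Submodule.nontrivial_iff_ne_bot.mpr hA
  have hL : L ≠ ⊥ := by
    intro h1
    have : Subsingleton L := Submodule.subsingleton_iff_eq_bot.mpr h1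
    have := hq.subsingleton
    exact not_subsingleton A this
  have hinj := (hP.sub hL).inj_of_proj hp q hq
  have hpi : Function.Injective p := by
    have : Nontrivial L := Submodule.nontrivial_iff_ne_bot.mpr hL
    refine hP.inj_of_inj L.subtype p ?_
    intro x y hxy
    apply hinj
    exact Subtype.ext (congrArg (fun z : B => (z : M)) hxy)
  exact Module.Projective.of_equiv (LinearEquiv.ofBijective p ⟨hpi, hps⟩)

/-- Lemma B: `Q` uniserial projective such that no proper nonzero submodule containing `A` is
projective. -/
lemma ext_black {Q W : Type u} [AddCommGroup Q] [Module R Q] [AddCommGroup W] [Module R W]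
    (hQ : US R Q) (hW : US R W) (hWp : Module.Projective R W)
    (hb : ∀ N : Submodule R Q, len R N + 1 = len R Q → ¬ Module.Projective R N)
    (A : Submodule R Q) (φ : A →ₗ[R] W) : ∃ ψ : Q →ₗ[R] W, ψ ∘ₗ A.subtype = φ := by
  have := hQ.fin
  have := hW.fin
  by_cases hφ : φ = 0
  · exact ⟨0, by rw [hφ]; rfl⟩
  rcases ext_alt hQ hW A φ hφ with h | ⟨K, γ, hKA, hAK, hγ, hlt, hγφ⟩
  · exact h
  exfalso
  obtain ⟨h, hh⟩ := Module.projective_lifting_property K.mkQ γ K.mkQ_surjective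
  have hh' : ∀ w, K.mkQ (h w) = γ w := fun w => congrArg (fun g => g w) hh
  have hinj : Function.Injective h := by
    intro x y hxy
    apply hγ
    rw [← hh', ← hh', hxy]
  have hle : ∀ a : A, (a : Q) - h (φ a) ∈ K := by
    intro a
    rw [← Submodule.Quotient.mk_eq_zero, Submodule.Quotient.mk_sub, sub_eq_zero]
    exact ((hh' (φ a)).trans (hγφ a)).symm
  have hne : LinearMap.range h ≠ ⊥ := by
    intro h0
    have : h = 0 := LinearMap.range_eq_bot.mp h0
    have hW' := hW.nt
    obtain ⟨x, hx⟩ := exists_ne (0 : W)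
    exact hx (hinj (by simp [this]))
  have hl := len_congr (LinearEquiv.ofInjective h hinj)
  have hq := len_quot K
  obtain ⟨N, hN⟩ := exists_len (R := R) (M := Q) (len R Q - 1) (by omega)
  refine hb N (by omega) ?_
  refine proj_of_sub_proj hQ (A := LinearMap.range h) ?_ hne
    (Module.Projective.of_equiv (LinearEquiv.ofInjective h hinj))
  rw [hQ.le_iff]
  omega

end PartB

set_option linter.unusedSectionVars false
section PartC
variable {R : Type u} [Ring R] [IsNakayama R]
variable {M N X : Type u} [AddCommGroup M] [Module R M] [AddCommGroup N] [Module R N]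
  [AddCommGroup X] [Module R X]

/-- A finite family of representatives of the indecomposable projective modules. -/
structure Lab {V : Type} (P : V → ModuleCat.{u} R) : Prop where
  us : ∀ v, US R (P v)
  proj : ∀ v, Module.Projective R (P v)
  inj : ∀ v w, Nonempty ((P v : Type u) ≃ₗ[R] (P w : Type u)) → v = w
  dec : ∃ (ι : Type) (_ : Fintype ι) (l : ι → V), Function.Surjective l ∧
    Nonempty (R ≃ₗ[R] (Π i, P (l i)))

lemma exists_lab : ∃ (V : Type) (_ : Finite V) (P : V → ModuleCat.{u} R), Lab P := by
  obtain ⟨ι, _, W, hW, ⟨e⟩⟩ := exists_decomp (R := R) R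
  let S : Setoid ι := ⟨fun i j => Nonempty ((W i : Type u) ≃ₗ[R] (W j : Type u)),
    fun i => ⟨LinearEquiv.refl _ _⟩, fun ⟨e⟩ => ⟨e.symm⟩, fun ⟨e⟩ ⟨f⟩ => ⟨e.trans f⟩⟩
  refine ⟨Quotient S, inferInstance, fun v => W v.out, fun v => hW _,
    fun v => proj_of_decomp W e _, ?_, ι, inferInstance, fun i => Quotient.mk S i,
    Quotient.mk_surjective, ?_⟩
  · intro v w h
    rw [← v.out_eq, ← w.out_eq]
    exact Quotient.sound h
  · have h : ∀ i, Nonempty ((W i : Type u) ≃ₗ[R] (W (Quotient.mk S i).out : Type u)) := by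
      intro i
      have : S (Quotient.mk S i).out i := Quotient.mk_out i
      obtain ⟨f⟩ := this
      exact ⟨f.symm⟩
    have f := fun i => (h i).some
    exact ⟨e.trans (LinearEquiv.piCongrRight f)⟩

/-- `v` is the label of the top of `M`. -/
def HasTop {V : Type} (P : V → ModuleCat.{u} R) (v : V) (M : Type u) [AddCommGroup M]
    [Module R M] : Prop := ∃ p : P v →ₗ[R] M, Function.Surjective p

variable {V : Type} {P : V → ModuleCat.{u} R}

lemma Lab.cover (hP : Lab P) (h : US R M) : ∃ v, HasTop P v M := by
  obtain ⟨ι, _, l, hl, ⟨e⟩⟩ := hP.dec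
  obtain ⟨i, p, hp⟩ := exists_cover_decomp (fun i => P (l i)) e h
  exact ⟨l i, p, hp⟩

lemma HasTop.surj {v : V} (h : HasTop P v M) (f : M →ₗ[R] N) (hf : Function.Surjective f) :
    HasTop P v N := by
  obtain ⟨p, hp⟩ := h
  exact ⟨f ∘ₗ p, hf.comp hp⟩

lemma HasTop.congr {v : V} (h : HasTop P v M) (e : M ≃ₗ[R] N) : HasTop P v N :=
  h.surj e.toLinearMap e.surjective

lemma HasTop.self (v : V) : HasTop P v (P v) := ⟨LinearMap.id, Function.surjective_id⟩

lemma Lab.top_unique (hP : Lab P) [Nontrivial M] {v w : V} (hv : HasTop P v M)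
    (hw : HasTop P w M) : v = w := by
  obtain ⟨p, hp⟩ := hv
  obtain ⟨q, hq⟩ := hw
  have := hP.proj v
  obtain ⟨h, hh⟩ := Module.projective_lifting_property q p hq
  have hs : Function.Surjective h := (hP.us w).surj_of_comp q h (by rw [hh]; exact hp)
  have := (hP.us w).nt
  exact hP.inj v w ⟨LinearEquiv.ofBijective h ⟨(hP.us v).inj_of_proj (hP.proj w) h hs, hs⟩⟩

lemma HasTop.us {v : V} (hP : Lab P) [Nontrivial M] (h : HasTop P v M) : US R M := by
  obtain ⟨p, hp⟩ := h
  exact (hP.us v).of_surj p hp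

lemma HasTop.iso {v : V} (hP : Lab P) (h : HasTop P v M) (h' : HasTop P v N)
    (hl : len R M = len R N) : Nonempty (M ≃ₗ[R] N) := by
  obtain ⟨p, hp⟩ := h
  obtain ⟨q, hq⟩ := h'
  have := (hP.us v).fin
  have h1 := len_surj p hp
  have h2 := len_surj q hq
  have hk : LinearMap.ker p = LinearMap.ker q := (hP.us v).eq_of_len (by omega)
  exact ⟨(p.quotKerEquivOfSurjective hp).symm.trans
    ((Submodule.quotEquivOfEq _ _ hk).trans (q.quotKerEquivOfSurjective hq))⟩

lemma HasTop.len_le {v : V} (hP : Lab P) (h : HasTop P v M) : len R M ≤ len R (P v) := by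
  obtain ⟨p, hp⟩ := h
  have := (hP.us v).fin
  have := len_surj p hp
  omega

lemma HasTop.proj_of_len {v : V} (hP : Lab P) (h : HasTop P v M) (hl : len R (P v) ≤ len R M) :
    Module.Projective R M := by
  obtain ⟨p, hp⟩ := h
  have := (hP.us v).fin
  have := hP.proj v
  exact Module.Projective.of_equiv (LinearEquiv.ofBijective p ⟨inj_of_surj p hp hl, hp⟩)

lemma HasTop.len_of_proj {v : V} (hP : Lab P) [Nontrivial M] (h : HasTop P v M)
    (hp : Module.Projective R M) : len R (P v) = len R M := by
  obtain ⟨p, hps⟩ := h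
  exact len_congr (LinearEquiv.ofBijective p ⟨(hP.us v).inj_of_proj hp p hps, hps⟩)

/-- `τ` gives the top of the radical. -/
structure TauSpec (P : V → ModuleCat.{u} R) (τ : V → V) : Prop where
  two : ∀ v, 2 ≤ len R (P v)
  spec : ∀ (v : V) (K : Submodule R (P v)), len R K + 1 = len R (P v) → HasTop P (τ v) K

lemma exists_tau (hP : Lab P) (h0 : NoSimpleProjectives R) : ∃ τ : V → V, TauSpec P τ := by
  have h2 : ∀ v, 2 ≤ len R (P v) := by
    intro v
    have := (hP.us v).fin
    have := (hP.us v).nt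
    have h1 := len_pos (R := R) (M := P v)
    by_contra h
    exact h0 (P v) (simple_of_len (by omega)) (hP.proj v)
  have h3 : ∀ v, ∃ w, ∀ K : Submodule R (P v), len R K + 1 = len R (P v) → HasTop P w K := by
    intro v
    have := (hP.us v).fin
    have := h2 v
    obtain ⟨K, hK⟩ := exists_len (R := R) (M := P v) (len R (P v) - 1) (by omega)
    have hne : K ≠ ⊥ := by
      rintro rfl
      rw [len_bot] at hK; omega
    obtain ⟨w, hw⟩ := hP.cover ((hP.us v).sub hne)
    refine ⟨w, fun K' hK' => ?_⟩
    have : K' = K := (hP.us v).eq_of_len (by omega)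
    rw [this]; exact hw
  choose τ hτ using h3
  exact ⟨τ, h2, hτ⟩

variable {τ : V → V}

lemma tau_step (hP : Lab P) (hτ : TauSpec P τ) {v : V} (hM : HasTop P v M)
    (K : Submodule R M) (hK : len R K + 1 = len R M) : HasTop P (τ v) K := by
  obtain ⟨p, hp⟩ := hM
  have := (hP.us v).fin
  have : Module.Finite R M := Module.Finite.of_surjective p hp
  let L := K.comap p
  have hL : len R L + 1 = len R (P v) := by
    have h1 := len_quot L
    have h2 := len_quot K
    have h3 : LinearMap.ker (K.mkQ ∘ₗ p) = L := by
      rw [LinearMap.ker_comp, Submodule.ker_mkQ]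
    have h4 := len_surj (K.mkQ ∘ₗ p) (K.mkQ_surjective.comp hp)
    rw [h3] at h4
    omega
  refine (hτ.spec v L hL).surj (p.restrict (p := L) (q := K) (fun x hx => hx)) ?_
  rintro ⟨y, hy⟩
  obtain ⟨x, rfl⟩ := hp y
  exact ⟨⟨x, hy⟩, rfl⟩

lemma tau_iter_aux (hP : Lab P) (hτ : TauSpec P τ) (k : ℕ) : ∀ (v : V) (M : Type u)
    [AddCommGroup M] [Module R M], US R M → HasTop P v M →
    ∀ (K : Submodule R M), K ≠ ⊥ → len R K + k = len R M → HasTop P (τ^[k] v) K := by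
  induction k with
  | zero =>
    intro v M _ _ hU hM K hK hl
    have := hU.fin
    have : K = ⊤ := sub_top_of_len (by omega)
    subst this
    exact hM.congr Submodule.topEquiv.symm
  | succ k ih =>
    intro v M _ _ hU hM K hK hl
    have := hU.fin
    obtain ⟨K1, hK1⟩ := exists_len (R := R) (M := M) (len R M - 1) (by omega)
    have hle : K ≤ K1 := hU.le_iff.mpr (by omega)
    have hne : K1 ≠ ⊥ := fun h => hK (le_bot_iff.mp (h ▸ hle))
    have h1 := tau_step hP hτ hM K1 (by omega)
    have e := Submodule.comapSubtypeEquivOfLe hle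
    refine (ih (τ v) K1 (hU.sub hne) h1 (K.comap K1.subtype) ?_ ?_).congr e
    · rw [← Submodule.nontrivial_iff_ne_bot]
      have : Nontrivial K := Submodule.nontrivial_iff_ne_bot.mpr hK
      exact e.toEquiv.nontrivial
    · rw [len_comap hle]; omega

lemma tau_iter (hP : Lab P) (hτ : TauSpec P τ) {k : ℕ} {v : V} (hU : US R M) (hM : HasTop P v M)
    (K : Submodule R M) (hK : K ≠ ⊥) (hl : len R K + k = len R M) : HasTop P (τ^[k] v) K :=
  tau_iter_aux hP hτ k v M hU hM K hK hl

lemma ne_bot_of_len [Module.Finite R M] {K : Submodule R M} (h : 0 < len R K) : K ≠ ⊥ := by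
  rintro rfl
  rw [len_bot] at h; omega

lemma ne_top_of_len [Module.Finite R M] {K : Submodule R M} (h : len R K < len R M) : K ≠ ⊤ := by
  rintro rfl
  rw [len_congr Submodule.topEquiv] at h; omega

lemma tau_inj (hP : Lab P) (hτ : TauSpec P τ) : Function.Injective τ := by
  intro v w hvw
  have key : ∀ v, ∃ (U : ModuleCat.{u} R) (K : Submodule R U), US R U ∧ HasTop P v U ∧
      len R U = 2 ∧ len R K = 1 ∧ HasTop P (τ v) K := by
    intro v
    have := (hP.us v).fin
    have h2 := hτ.two v
    obtain ⟨K, hK⟩ := exists_len (R := R) (M := P v) (len R (P v) - 2) (by omega)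
    have hq := len_quot K
    have hU := (hP.us v).quot (K := K) (ne_top_of_len (by omega))
    have hT : HasTop P v (P v ⧸ K) := (HasTop.self v).surj K.mkQ K.mkQ_surjective
    obtain ⟨K1, hK1⟩ := exists_len (R := R) (M := P v ⧸ K) 1 (by omega)
    exact ⟨ModuleCat.of R (P v ⧸ K), K1, hU, hT, by change len R (P v ⧸ K) = 2; omega, hK1,
      tau_step hP hτ hT K1 (by omega)⟩
  obtain ⟨U, K, hU, hUt, hUl, hKl, hKt⟩ := key v
  obtain ⟨U', K', hU', hUt', hUl', hKl', hKt'⟩ := key w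
  rw [← hvw] at hKt'
  have := hU.fin
  have := hU'.fin
  obtain ⟨e⟩ := hKt.iso hP hKt' (by omega)
  have : Nontrivial K := Submodule.nontrivial_iff_ne_bot.mpr (ne_bot_of_len (by omega))
  obtain ⟨γ, hγ, -⟩ := pushout hU hU' K.subtype (K'.subtype ∘ₗ e.toLinearMap) K.subtype_injective
    (K'.subtype_injective.comp e.injective) (by omega)
  have hs := surj_of_inj γ hγ (by omega)
  have := hU'.nt
  exact hP.top_unique (hUt.surj γ hs) hUt'

/-- nonzero maps between indecomposable projectives stay in a `τ`-orbit -/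
lemma hom_orbit (hP : Lab P) (hτ : TauSpec P τ) {v w : V} (f : P w →ₗ[R] P v) (hf : f ≠ 0) :
    ∃ k, τ^[k] v = w := by
  have := (hP.us v).fin
  have hne : LinearMap.range f ≠ ⊥ := fun h => hf (LinearMap.range_eq_bot.mp h)
  have h1 := len_sub_le (LinearMap.range f)
  have h2 := tau_iter hP hτ (k := len R (P v) - len R (LinearMap.range f)) (hP.us v)
    (HasTop.self v) _ hne (by omega)
  have : Nontrivial (LinearMap.range f) := Submodule.nontrivial_iff_ne_bot.mpr hne
  exact ⟨_, hP.top_unique h2 ⟨f.rangeRestrict, f.surjective_rangeRestrict⟩⟩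

lemma tau_orbit [Finite V] (hP : Lab P) (hτ : TauSpec P τ) (hc : IsConnectedAlg R) (v w : V) :
    ∃ k, τ^[k] v = w := by
  classical
  -- reachability is symmetric
  have hsymm : ∀ x y, (∃ k, τ^[k] x = y) → ∃ k, τ^[k] y = x := by
    rintro x y ⟨k, rfl⟩
    obtain ⟨n, hn, hx⟩ := Function.Injective.mem_periodicPts (tau_inj hP hτ) x
    refine ⟨n * k - k, ?_⟩
    have h1 : k ≤ n * k := Nat.le_mul_of_pos_left k hn
    rw [← Function.iterate_add_apply, Nat.sub_add_cancel h1]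
    exact hx.mul_const k
  obtain ⟨ι, _, l, hl, ⟨e⟩⟩ := hP.dec
  let π : (Π i, P (l i)) →ₗ[R] (Π i, P (l i)) :=
    LinearMap.pi (fun i => if (∃ k, τ^[k] v = l i) then LinearMap.proj i else 0)
  have hπ : ∀ x i, π x i = if (∃ k, τ^[k] v = l i) then x i else 0 := by
    intro x i
    simp only [π, LinearMap.pi_apply]
    split_ifs <;> rfl
  -- `π` commutes with all endomorphisms
  have hcomm : ∀ g : (Π i, P (l i)) →ₗ[R] (Π i, P (l i)), π ∘ₗ g = g ∘ₗ π := by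
    intro g
    apply LinearMap.pi_ext'
    intro i
    ext x j
    simp only [LinearMap.comp_apply, LinearMap.single_apply]
    have hz : π (Pi.single i x) = if (∃ k, τ^[k] v = l i) then Pi.single i x else 0 := by
      funext j
      rw [hπ]
      by_cases hij : i = j
      · subst hij
        split_ifs <;> simp
      · split_ifs <;> simp [Pi.single_eq_of_ne' hij]
    rw [hz, hπ]
    by_cases hi : ∃ k, τ^[k] v = l i <;> by_cases hj : ∃ k, τ^[k] v = l j
    · rw [if_pos hi, if_pos hj]
    · rw [if_pos hi, if_neg hj]
      by_contra hne
      have : (LinearMap.proj j ∘ₗ g ∘ₗ LinearMap.single R (fun i => (P (l i) : Type u)) i) ≠ 0 := by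
        intro h0
        exact hne (congrArg (fun q => q x) h0).symm
      obtain ⟨k, hk⟩ := hom_orbit hP hτ _ this
      obtain ⟨m, hm⟩ := hsymm _ _ ⟨k, hk⟩
      obtain ⟨n, hn⟩ := hi
      exact hj ⟨m + n, by rw [Function.iterate_add_apply, hn, hm]⟩
    · rw [if_neg hi, if_pos hj]
      by_contra hne
      have : (LinearMap.proj j ∘ₗ g ∘ₗ LinearMap.single R (fun i => (P (l i) : Type u)) i) ≠ 0 := by
        intro h0
        refine hne ?_
        rw [map_zero]
        exact (congrArg (fun q => q x) h0)
      obtain ⟨k, hk⟩ := hom_orbit hP hτ _ this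
      obtain ⟨n, hn⟩ := hj
      exact hi ⟨k + n, by rw [Function.iterate_add_apply, hn, hk]⟩
    · rw [if_neg hi, if_neg hj, map_zero]; rfl
  let ε : R := e.symm (π (e 1))
  have hε : ∀ x : R, e.symm (π (e x)) = x * ε := by
    intro x
    have : x = x • (1 : R) := by simp
    conv_lhs => rw [this, map_smul, map_smul, map_smul]
    rfl
  have hππ : ∀ y, π (π y) = π y := by
    intro y; funext i
    rw [hπ, hπ]; split_ifs <;> rfl
  have hid : IsIdempotentElem ε := by
    change ε * ε = ε
    rw [← hε ε]
    simp only [ε, LinearEquiv.apply_symm_apply, hππ]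
  have hcen : ∀ x : R, ε * x = x * ε := by
    intro x
    let g : (Π i, P (l i)) →ₗ[R] (Π i, P (l i)) :=
      e.toLinearMap ∘ₗ (LinearMap.toSpanSingleton R R x) ∘ₗ e.symm.toLinearMap
    have h1 := congrArg (fun q => e.symm (q (e 1))) (hcomm g)
    simp only [g, LinearMap.comp_apply, LinearEquiv.coe_coe, LinearEquiv.symm_apply_apply,
      LinearMap.toSpanSingleton_apply, one_smul, smul_eq_mul, one_mul] at h1
    rw [hε] at h1
    exact h1.symm
  obtain ⟨i, rfl⟩ := hl v
  obtain ⟨j, rfl⟩ := hl w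
  rcases hc ε hid hcen with h | h
  · exfalso
    have := (hP.us (l i)).nt
    obtain ⟨x, hx⟩ := exists_ne (0 : P (l i))
    have h1 := hε (e.symm (Pi.single i x))
    rw [h, mul_zero, LinearEquiv.apply_symm_apply, LinearEquiv.map_eq_zero_iff] at h1
    have h2 := congrArg (fun q => q i) h1
    simp only [hπ, Pi.single_eq_same] at h2
    rw [if_pos ⟨0, rfl⟩] at h2
    exact hx h2
  · by_contra hcon
    have := (hP.us (l j)).nt
    obtain ⟨x, hx⟩ := exists_ne (0 : P (l j))
    have h1 := hε (e.symm (Pi.single j x))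
    rw [h, mul_one, LinearEquiv.apply_symm_apply] at h1
    have h2 := congrArg (fun q => q j) (e.symm.injective h1)
    simp only [hπ, Pi.single_eq_same] at h2
    rw [if_neg hcon] at h2
    exact hx h2.symm

end PartC

set_option linter.unusedSectionVars false
section PartE1
variable {R : Type u} [Ring R]

/-- A complete resolution. -/
structure CR (R : Type u) [Ring R] where
  P : ℤ → ModuleCat.{u} R
  d : ∀ i, P (i + 1) →ₗ[R] P i
  proj : ∀ i, Module.Projective R (P i)
  exact : ∀ i, Function.Exact (d (i + 1)) (d i)
  hom : ∀ (i : ℤ) (φ : P (i + 1) →ₗ[R] R), φ.comp (d (i + 1)) = 0 →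
      ∃ ψ : P i →ₗ[R] R, ψ.comp (d i) = φ

/-- `A` is a retract of a syzygy of a complete resolution. -/
def RG (R : Type u) [Ring R] (A : Type u) [AddCommGroup A] [Module R A] : Prop :=
  ∃ (C : CR R) (n : ℤ) (i : A →ₗ[R] LinearMap.range (C.d n)) (r : LinearMap.range (C.d n) →ₗ[R] A),
    ∀ a, r (i a) = a

variable {M N X : Type u} [AddCommGroup M] [Module R M] [AddCommGroup N] [Module R N]
  [AddCommGroup X] [Module R X]

lemma RG.of_gp (h : IsGorensteinProjective R M) (i : N →ₗ[R] M) (r : M →ₗ[R] N)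
    (hir : ∀ a, r (i a) = a) : RG R N := by
  obtain ⟨P, d, h1, h2, h3, ⟨e⟩⟩ := h
  exact ⟨⟨P, d, h1, h2, h3⟩, 0, e.toLinearMap ∘ₗ i, r ∘ₗ e.symm.toLinearMap,
    fun a => by simp [hir]⟩

lemma RG.congr (h : RG R M) (e : M ≃ₗ[R] N) : RG R N := by
  obtain ⟨C, n, i, r, hir⟩ := h
  exact ⟨C, n, i ∘ₗ e.symm.toLinearMap, e.toLinearMap ∘ₗ r, fun a => by simp [hir]⟩

lemma GP.congr (h : IsGorensteinProjective R M) (e : M ≃ₗ[R] N) : IsGorensteinProjective R N := by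
  obtain ⟨P, d, h1, h2, h3, ⟨f⟩⟩ := h
  exact ⟨P, d, h1, h2, h3, ⟨e.symm.trans f⟩⟩

lemma GP.of_proj (h : Module.Projective R M) : IsGorensteinProjective R M := by
  let d : M × M →ₗ[R] M × M := LinearMap.inl R M M ∘ₗ LinearMap.snd R M M
  refine ⟨fun _ => ModuleCat.of R (M × M), fun _ => d, fun _ => ?_, fun _ => ?_, fun _ φ hφ => ?_, ⟨?_⟩⟩
  · change Module.Projective R (M × M)
    infer_instance
  · rintro ⟨x, y⟩
    change (y, (0 : M)) = 0 ↔ _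
    constructor
    · intro h
      have : y = 0 := congrArg Prod.fst h
      exact ⟨(0, x), by subst this; rfl⟩
    · rintro ⟨⟨a, b⟩, hab⟩
      have h1 : (b, (0 : M)) = (x, y) := hab
      have : y = 0 := (congrArg Prod.snd h1).symm
      rw [this]; rfl
  · change M × M →ₗ[R] R at φ
    refine ⟨(φ ∘ₗ LinearMap.inr R M M) ∘ₗ LinearMap.fst R M M, ?_⟩
    have h1 : ∀ x : M, φ (x, 0) = 0 := fun x => congrArg (fun g => g ((0 : M), x)) hφ
    apply LinearMap.ext
    rintro ⟨x, y⟩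
    change φ (0, y) = φ (x, y)
    have : (x, y) = (x, 0) + (0, y) := by simp
    rw [this, map_add, h1, zero_add]
  · refine (LinearEquiv.ofInjective (LinearMap.inl R M M) LinearMap.inl_injective).trans
      (LinearEquiv.ofEq _ _ ?_)
    change _ = LinearMap.range d
    apply le_antisymm
    · rintro _ ⟨x, rfl⟩
      exact ⟨(0, x), rfl⟩
    · rintro _ ⟨x, rfl⟩
      exact ⟨x.2, rfl⟩

variable [IsNakayama R]
variable {V : Type} {P : V → ModuleCat.{u} R} {τ : V → V}

lemma Lab.summand (hP : Lab P) (v : V) : ∃ (s : P v →ₗ[R] R) (t : R →ₗ[R] P v), ∀ x, t (s x) = x := by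
  classical
  obtain ⟨ι, _, l, hl, ⟨e⟩⟩ := hP.dec
  obtain ⟨i, rfl⟩ := hl v
  exact ⟨e.symm.toLinearMap ∘ₗ LinearMap.single R (fun i => (P (l i) : Type u)) i,
    LinearMap.proj i ∘ₗ e.toLinearMap, fun x => by simp⟩

lemma CR.ext (hP : Lab P) (C : CR R) (n : ℤ) (w : V) (φ : LinearMap.range (C.d n) →ₗ[R] P w) :
    ∃ ψ : C.P n →ₗ[R] P w, ∀ x, ψ (x : LinearMap.range (C.d n)) = φ x := by
  obtain ⟨s, t, hst⟩ := hP.summand w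
  obtain ⟨ψ, hψ⟩ := C.hom n (s ∘ₗ φ ∘ₗ (C.d n).rangeRestrict) (by
    ext x
    have : (C.d n).rangeRestrict (C.d (n + 1) x) = 0 :=
      Subtype.ext ((C.exact n (C.d (n+1) x)).mpr ⟨x, rfl⟩)
    simp [this])
  refine ⟨t ∘ₗ ψ, ?_⟩
  rintro ⟨_, x, rfl⟩
  have := congrArg (fun g => g x) hψ
  simp only [LinearMap.comp_apply] at this
  simp only [LinearMap.comp_apply, this, hst]
  rfl

/-- The radical of `P v` is not projective. -/
def Black (P : V → ModuleCat.{u} R) (v : V) : Prop :=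
  ∀ K : Submodule R (P v), len R K + 1 = len R (P v) → ¬ Module.Projective R K

lemma cover_split (hP : Lab P) [Nontrivial M] (hM : RG R M) {v : V} (p : P v →ₗ[R] M)
    (hp : Function.Surjective p) : ∃ (C : CR R) (n : ℤ) (i : P v →ₗ[R] C.P (n + 1))
      (r : C.P (n + 1) →ₗ[R] P v), (∀ x, r (i x) = x) ∧
      (∀ x ∈ LinearMap.ker p, i x ∈ LinearMap.range (C.d (n + 1))) ∧
      (∀ y ∈ LinearMap.range (C.d (n + 1)), r y ∈ LinearMap.ker p) := by
  obtain ⟨C, n, i, r, hir⟩ := hM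
  have := hP.proj v
  have := C.proj (n + 1)
  have := (hP.us v).fin
  obtain ⟨i1, hi1⟩ := Module.projective_lifting_property (C.d n).rangeRestrict (i ∘ₗ p)
    (C.d n).surjective_rangeRestrict
  obtain ⟨r1, hr1⟩ := Module.projective_lifting_property p (r ∘ₗ (C.d n).rangeRestrict) hp
  have hi : ∀ x, (C.d n).rangeRestrict (i1 x) = i (p x) := fun x => congrArg (fun g => g x) hi1
  have hr : ∀ x, p (r1 x) = r ((C.d n).rangeRestrict x) := fun x => congrArg (fun g => g x) hr1
  have hu : ∀ x, p (r1 (i1 x)) = p x := fun x => by rw [hr, hi, hir]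
  have hs : Function.Surjective (r1 ∘ₗ i1) := (hP.us v).surj_of_comp p (r1 ∘ₗ i1) (by
    intro y
    obtain ⟨x, rfl⟩ := hp y
    exact ⟨x, hu x⟩)
  let u := LinearEquiv.ofBijective (r1 ∘ₗ i1) ⟨inj_of_surj _ hs le_rfl, hs⟩
  have hu1 : ∀ x, u x = r1 (i1 x) := fun x => rfl
  have hu2 : ∀ x, p (u.symm x) = p x := by
    intro x
    rw [← hu, ← hu1, LinearEquiv.apply_symm_apply]
  refine ⟨C, n, i1, u.symm.toLinearMap ∘ₗ r1, ?_, ?_, ?_⟩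
  · intro x
    simp [← hu1]
  · intro x hx
    apply (C.exact n _).mp
    have := congrArg Subtype.val (hi x)
    rw [LinearMap.mem_ker.mp hx, map_zero] at this
    exact this
  · intro y hy
    rw [LinearMap.mem_ker]
    change p (u.symm (r1 y)) = 0
    rw [hu2, hr]
    have : (C.d n).rangeRestrict y = 0 := Subtype.ext ((C.exact n y).mpr hy)
    rw [this, map_zero]

lemma RG.ker (hP : Lab P) [Nontrivial M] (hM : RG R M) {v : V} (p : P v →ₗ[R] M)
    (hp : Function.Surjective p) : RG R (LinearMap.ker p) := by
  obtain ⟨C, n, i, r, h1, h2, h3⟩ := cover_split hP hM p hp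
  exact ⟨C, n + 1, i.restrict h2, r.restrict h3, fun a => Subtype.ext (h1 a)⟩

lemma exists_lab_of_proj (hP : Lab P) (hM : US R M) (hp : Module.Projective R M) :
    ∃ w, Nonempty (M ≃ₗ[R] P w) := by
  obtain ⟨w, p, hps⟩ := hP.cover hM
  have := hM.nt
  exact ⟨w, ⟨(LinearEquiv.ofBijective p ⟨(hP.us w).inj_of_proj hp p hps, hps⟩).symm⟩⟩

lemma RG.black (hP : Lab P) [Nontrivial M] (hM : RG R M) {v : V} (hv : HasTop P v M)
    (hnp : ¬ Module.Projective R M) : Black P v := by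
  obtain ⟨p, hp⟩ := hv
  obtain ⟨C, n, i, r, h1, h2, h3⟩ := cover_split hP hM p hp
  intro N hN hNp
  have := (hP.us v).fin
  have hl := len_surj p hp
  have : Module.Finite R M := Module.Finite.of_surjective p hp
  have hpos := len_pos (R := R) (M := M)
  have hle : LinearMap.ker p ≤ N := (hP.us v).le_iff.mpr (by omega)
  have hK : LinearMap.ker p ≠ ⊥ := by
    intro h
    have := hP.proj v
    exact hnp (Module.Projective.of_equiv (LinearEquiv.ofBijective p ⟨LinearMap.ker_eq_bot.mp h, hp⟩))
  have hNne : N ≠ ⊥ := fun h => hK (le_bot_iff.mp (h ▸ hle))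
  obtain ⟨w, ⟨e⟩⟩ := exists_lab_of_proj hP ((hP.us v).sub hNne) hNp
  let φ : LinearMap.ker p →ₗ[R] P w := e.toLinearMap ∘ₗ Submodule.inclusion hle
  obtain ⟨θ, hθ⟩ := C.ext hP (n + 1) w (φ ∘ₗ r.restrict h3)
  have : Nontrivial (LinearMap.ker p) := Submodule.nontrivial_iff_ne_bot.mpr hK
  have hinj : Function.Injective (θ ∘ₗ i) := by
    apply (hP.us v).inj_of_inj (LinearMap.ker p).subtype
    have : (θ ∘ₗ i) ∘ₗ (LinearMap.ker p).subtype = φ := by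
      ext x
      have := hθ ⟨i x, h2 x x.2⟩
      change θ (i x) = _
      rw [this]
      change φ _ = φ x
      congr 1
      exact Subtype.ext (h1 x)
    rw [this]
    exact e.injective.comp (Submodule.inclusion_injective hle)
  have := (hP.us w).fin
  have := len_inj _ hinj
  have := len_congr e
  omega

/-- extension of maps into projectives -/
lemma ext_black_proj (hP : Lab P) {w : V} (hw : Black P w) (hX : Module.Projective R X)
    (A : Submodule R (P w)) (φ : A →ₗ[R] X) : ∃ ψ : P w →ₗ[R] X, ∀ a : A, ψ a = φ a := by
  classical
  have hR : ∀ φ : A →ₗ[R] R, ∃ ψ : P w →ₗ[R] R, ∀ a : A, ψ a = φ a := by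
    intro φ
    obtain ⟨ι, _, l, hl, ⟨e⟩⟩ := hP.dec
    have := fun i => ext_black (hP.us w) (hP.us (l i)) (hP.proj (l i)) hw A
      (LinearMap.proj i ∘ₗ e.toLinearMap ∘ₗ φ)
    choose ψ hψ using this
    refine ⟨e.symm.toLinearMap ∘ₗ LinearMap.pi ψ, fun a => ?_⟩
    apply e.injective
    simp only [LinearMap.comp_apply, LinearEquiv.coe_coe, LinearEquiv.apply_symm_apply]
    funext i
    exact congrArg (fun g => g a) (hψ i)
  have := (hP.us w).fin
  obtain ⟨s, hs⟩ := Module.projective_def.mp hX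
  obtain ⟨T, hT⟩ := (inferInstance : Module.Finite R A)
  let F : Finset X := T.biUnion (fun a => (s (φ a)).support)
  have hF : ∀ a : A, s (φ a) ∈ Finsupp.supported R R (F : Set X) := by
    intro a
    have : (⊤ : Submodule R A) ≤ (Finsupp.supported R R (F : Set X)).comap (s ∘ₗ φ) := by
      rw [← hT, Submodule.span_le]
      intro x hx y hy
      exact Finset.mem_biUnion.mpr ⟨x, hx, hy⟩
    exact this trivial
  have := fun b : X => hR (Finsupp.lapply b ∘ₗ s ∘ₗ φ)
  choose ψ hψ using this
  refine ⟨∑ b ∈ F, (LinearMap.toSpanSingleton R X b) ∘ₗ ψ b, fun a => ?_⟩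
  have h1 := hs (φ a)
  rw [Finsupp.linearCombination_apply, Finsupp.sum_of_support_subset _ (hF a) _ (by simp)] at h1
  rw [← h1, LinearMap.sum_apply]
  refine Finset.sum_congr rfl fun b _ => ?_
  simp only [LinearMap.comp_apply, hψ, LinearMap.toSpanSingleton_apply, Finsupp.lapply_apply, id]

lemma RG.embed (hP : Lab P) (hU : US R M) (hM : RG R M) : ∃ (w : V) (j : M →ₗ[R] P w),
    Function.Injective j := by
  obtain ⟨C, n, i, r, hir⟩ := hM
  obtain ⟨x, hx, hmin⟩ := hU.exists_min
  obtain ⟨s, hs⟩ := Module.projective_def.mp (C.proj n)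
  have h1 : s (i x : C.P n) ≠ 0 := by
    intro h
    have h2 := hs (i x : C.P n)
    rw [h, map_zero] at h2
    apply hx
    rw [← hir x]
    have : i x = 0 := Subtype.ext h2.symm
    rw [this, map_zero]
  obtain ⟨b, hb⟩ := Finsupp.ne_iff.mp h1
  obtain ⟨ι, _, l, hl, ⟨e⟩⟩ := hP.dec
  have h2 : e (s (i x : C.P n) b) ≠ 0 := by
    rw [Ne, LinearEquiv.map_eq_zero_iff]; exact hb
  obtain ⟨k, hk⟩ := Function.ne_iff.mp h2
  let j : M →ₗ[R] P (l k) := LinearMap.proj k ∘ₗ e.toLinearMap ∘ₗ Finsupp.lapply b ∘ₗ s ∘ₗ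
    (LinearMap.range (C.d n)).subtype ∘ₗ i
  refine ⟨l k, j, ?_⟩
  rw [← LinearMap.ker_eq_bot]
  by_contra hne
  exact hk (hmin _ hne)

lemma RG.coker (hP : Lab P) (hU : US R M) (hM : RG R M) (hnp : ¬ Module.Projective R M) :
    ∃ (w : V) (A : Submodule R (P w)), Black P w ∧ A ≠ ⊤ ∧ Nonempty (M ≃ₗ[R] A) ∧
      RG R (P w ⧸ A) := by
  classical
  have hex : ∃ n, ∃ w, len R (P w) = n ∧ ∃ j : M →ₗ[R] P w, Function.Injective j := by
    obtain ⟨w, j, hj⟩ := hM.embed hP hU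
    exact ⟨_, w, rfl, j, hj⟩
  obtain ⟨w, hwl, j, hj⟩ := Nat.find_spec hex
  have hmin : ∀ w', (∃ j : M →ₗ[R] P w', Function.Injective j) → len R (P w) ≤ len R (P w') := by
    rintro w' hj
    rw [hwl]
    exact Nat.find_min' hex ⟨w', rfl, hj⟩
  have := (hP.us w).fin
  have := hU.fin
  have hMn := hU.nt
  have hAt : LinearMap.range j ≠ ⊤ := by
    intro h
    have := hP.proj w
    exact hnp (Module.Projective.of_equiv (LinearEquiv.ofBijective j
      ⟨hj, LinearMap.range_eq_top.mp h⟩).symm)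
  have hAl : len R (LinearMap.range j) < len R (P w) := by
    by_contra h
    exact hAt (sub_top_of_len (by omega))
  let e : M ≃ₗ[R] LinearMap.range j := LinearEquiv.ofInjective j hj
  have hAn : Nontrivial (LinearMap.range j) := e.symm.toEquiv.nontrivial
  have hb : Black P w := by
    intro N hN hNp
    have hle : LinearMap.range j ≤ N := (hP.us w).le_iff.mpr (by omega)
    have hNne : N ≠ ⊥ := by
      have := len_pos (R := R) (M := LinearMap.range j)
      exact fun h => (Submodule.nontrivial_iff_ne_bot.mp hAn) (le_bot_iff.mp (h ▸ hle))
    obtain ⟨w', ⟨f⟩⟩ := exists_lab_of_proj hP ((hP.us w).sub hNne) hNp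
    have := hmin w' ⟨f.toLinearMap ∘ₗ Submodule.inclusion hle ∘ₗ e.toLinearMap,
      f.injective.comp ((Submodule.inclusion_injective hle).comp e.injective)⟩
    have := len_congr f
    omega
  refine ⟨w, LinearMap.range j, hb, hAt, ⟨e⟩, ?_⟩
  obtain ⟨C, n, i, r, hir⟩ := hM
  obtain ⟨m, rfl⟩ : ∃ m, n = m + 1 := ⟨n - 1, by omega⟩
  obtain ⟨r1, hr1⟩ := C.ext hP (m + 1) w (j ∘ₗ r)
  obtain ⟨i1, hi1⟩ := ext_black_proj hP hb (C.proj (m + 1)) (LinearMap.range j)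
    ((LinearMap.range (C.d (m + 1))).subtype ∘ₗ i ∘ₗ e.symm.toLinearMap)
  have hi : ∀ x, i1 (j x) = i x := by
    intro x
    have := hi1 (e x)
    simp only [LinearMap.comp_apply, LinearEquiv.coe_coe, LinearEquiv.symm_apply_apply] at this
    exact this
  have hid : ∀ x, r1 (i1 (j x)) = j x := by
    intro x
    rw [hi, hr1, LinearMap.comp_apply, hir]
  have hinj : Function.Injective (r1 ∘ₗ i1) := by
    apply (hP.us w).inj_of_inj j
    have : (r1 ∘ₗ i1) ∘ₗ j = j := LinearMap.ext hid
    rw [this]; exact hj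
  let u := LinearEquiv.ofBijective (r1 ∘ₗ i1) ⟨hinj, surj_of_inj _ hinj le_rfl⟩
  have hu1 : ∀ x, u x = r1 (i1 x) := fun x => rfl
  have hu2 : ∀ x, u.symm (j x) = j x := by
    intro x
    rw [LinearEquiv.symm_apply_eq, hu1, hid]
  have hk : ∀ y, y ∈ LinearMap.ker (C.d m) ↔ y ∈ LinearMap.range (C.d (m + 1)) :=
    fun y => C.exact m y
  have hA1 : LinearMap.range j ≤ (LinearMap.ker (C.d m)).comap i1 := by
    rintro _ ⟨x, rfl⟩
    rw [Submodule.mem_comap, hi, hk]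
    exact (i x).2
  have hA2 : LinearMap.ker (C.d m) ≤ (LinearMap.range j).comap (u.symm.toLinearMap ∘ₗ r1) := by
    intro y hy
    rw [hk] at hy
    refine ⟨r ⟨y, hy⟩, ?_⟩
    have := hr1 ⟨y, hy⟩
    change _ = u.symm (r1 y)
    change r1 y = _ at this
    rw [this, LinearMap.comp_apply, hu2]
  refine ⟨C, m, (C.d m).quotKerEquivRange.toLinearMap ∘ₗ Submodule.mapQ _ _ i1 hA1,
    Submodule.mapQ _ _ _ hA2 ∘ₗ (C.d m).quotKerEquivRange.symm.toLinearMap, fun a => ?_⟩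
  obtain ⟨a, rfl⟩ := Submodule.mkQ_surjective _ a
  simp [← hu1]

end PartE1

set_option linter.unusedSectionVars false
section PartF1
variable {V : Type} (τ : V → V) (c : V → ℕ) (B : V → Prop)

/-- labels lying on black cycles -/
def Good (v : V) : Prop := ∃ T : Set V, v ∈ T ∧ (∀ x ∈ T, B x) ∧ (∀ x ∈ T, τ^[c x] x ∈ T) ∧
  ∀ x ∈ T, ∃ y ∈ T, τ^[c y] y = x

/-- good intervals -/
def TT (a : V) (k : ℕ) : Prop := 0 < k ∧ k < c a ∧ Good τ c B a ∧ Good τ c B (τ^[k] a)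

/-- the combinatorial hypotheses -/
structure Comb : Prop where
  inj : Function.Injective τ
  pos : ∀ v, 0 < c v
  lt : ∀ v k, B v → 0 < k → k < c v → c v < k + c (τ^[k] v)

/-- minimal good intervals -/
def Emin (a : V) (k : ℕ) : Prop :=
  TT τ c B a k ∧ ∀ j, 0 < j → j < k → ¬ Good τ c B (τ^[j] a)

variable {τ c B}

lemma Good.black {v : V} (h : Good τ c B v) : B v := by
  obtain ⟨T, h1, h2, -⟩ := h; exact h2 _ h1

lemma Good.f {v : V} (h : Good τ c B v) : Good τ c B (τ^[c v] v) := by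
  obtain ⟨T, h1, h2, h3, h4⟩ := h; exact ⟨T, h3 _ h1, h2, h3, h4⟩

lemma Good.pre {v : V} (h : Good τ c B v) : ∃ w, Good τ c B w ∧ τ^[c w] w = v := by
  obtain ⟨T, h1, h2, h3, h4⟩ := h
  obtain ⟨y, hy, hyv⟩ := h4 _ h1
  exact ⟨y, ⟨T, hy, h2, h3, h4⟩, hyv⟩

lemma Comb.cancel (H : Comb τ c B) {i j : ℕ} {x y : V} (hij : i ≤ j) (h : τ^[i] x = τ^[j] y) :
    x = τ^[j - i] y := by
  apply H.inj.iterate i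
  rw [h, ← Function.iterate_add_apply]
  congr 2; omega

lemma Comb.fwd (H : Comb τ c B) {a : V} {k : ℕ} (h : TT τ c B a k) :
    TT τ c B (τ^[k] a) (c a - k) := by
  obtain ⟨h1, h2, h3, h4⟩ := h
  have := H.lt a k h3.black h1 h2
  refine ⟨by omega, by omega, h4, ?_⟩
  rw [← Function.iterate_add_apply, Nat.sub_add_cancel h2.le]
  exact h3.f

lemma Comb.bwd (H : Comb τ c B) {a : V} {k : ℕ} (h : TT τ c B a k) :
    ∃ w m, TT τ c B w m ∧ τ^[m] w = a ∧ c w = m + k := by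
  obtain ⟨h1, h2, h3, h4⟩ := h
  obtain ⟨w, hw, hwk⟩ := h4.pre
  have hk : k < c w := by
    by_contra hk
    have h5 := H.cancel (by omega) hwk
    rcases Nat.eq_zero_or_pos (k - c w) with h6 | h6
    · rw [h6] at h5
      have h7 : w = a := h5
      subst h7; omega
    · have := H.lt a (k - c w) h3.black h6 (by omega)
      rw [← h5] at this
      omega
  have h5 := H.cancel hk.le hwk.symm
  refine ⟨w, c w - k, ⟨by omega, by omega, hw, ?_⟩, h5.symm, by omega⟩
  rw [← h5]; exact h3

lemma Comb.f_inj (H : Comb τ c B) {x y : V} (hx : Good τ c B x) (hy : Good τ c B y)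
    (h : τ^[c x] x = τ^[c y] y) : x = y := by
  have key : ∀ x y : V, Good τ c B y → c x ≤ c y → τ^[c x] x = τ^[c y] y → x = y := by
    intro x y hy hl h
    have h5 := H.cancel hl h
    rcases Nat.eq_zero_or_pos (c y - c x) with h6 | h6
    · rw [h6] at h5; exact h5
    · have := H.pos x
      have := H.lt y (c y - c x) hy.black h6 (by omega)
      rw [← h5] at this
      omega
  rcases le_total (c x) (c y) with hl | hl
  · exact key x y hy hl h
  · exact (key y x hx hl h.symm).symm

lemma Comb.exists_TT (H : Comb τ c B) (horb : ∀ v w, ∃ k, τ^[k] v = w)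
    {a : V} {k : ℕ} (h : TT τ c B a k) {x : V} (hx : Good τ c B x) : ∃ i, TT τ c B x i := by
  by_contra hcon
  have hH : ∀ x, Good τ c B x → (¬ ∃ i, TT τ c B x i) → ¬ ∃ i, TT τ c B (τ^[c x] x) i := by
    rintro x hx hn ⟨i, hi⟩
    obtain ⟨w, m, hw, hwm, hc⟩ := H.bwd hi
    obtain ⟨w', m', hw', hwm', hc'⟩ := H.bwd hw
    have : w' = x := by
      apply H.f_inj hw'.2.2.1 hx
      rw [hc', add_comm, Function.iterate_add_apply, hwm', hwm]
    subst this
    exact hn ⟨m', hw'⟩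
  have key : ∀ N x, Good τ c B x → (¬ ∃ i, TT τ c B x i) → τ^[N] x ≠ a := by
    intro N
    induction N using Nat.strong_induction_on with
    | _ N ih =>
      intro x hx hn hN
      rcases Nat.eq_zero_or_pos N with h0 | h0
      · subst h0
        have h1 : x = a := hN
        subst h1
        exact hn ⟨k, h⟩
      · rcases lt_or_ge N (c x) with h1 | h1
        · exact hn ⟨N, h0, h1, hx, by rw [hN]; exact h.2.2.1⟩
        · have := H.pos x
          refine ih (N - c x) (by omega) (τ^[c x] x) hx.f (hH x hx hn) ?_
          rw [← Function.iterate_add_apply, Nat.sub_add_cancel h1, hN]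
  obtain ⟨N, hN⟩ := horb x a
  exact key N x hx hcon hN

lemma exists_Emin {x : V} (h : ∃ i, TT τ c B x i) : ∃ i, Emin τ c B x i := by
  classical
  refine ⟨Nat.find h, Nat.find_spec h, fun j hj hlt hg => Nat.find_min h hlt ?_⟩
  have := Nat.find_spec h
  exact ⟨hj, hlt.trans this.2.1, this.2.2.1, hg⟩

lemma Comb.exists_pos (H : Comb τ c B) (horb : ∀ v w, ∃ k, τ^[k] v = w)
    {a : V} {k : ℕ} (h : TT τ c B a k) (w : V) : ∃ x i N, Emin τ c B x i ∧ N < i ∧ τ^[N] x = w := by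
  classical
  have hex : ∃ N x, Good τ c B x ∧ τ^[N] x = w := by
    obtain ⟨N, hN⟩ := horb a w
    exact ⟨N, a, h.2.2.1, hN⟩
  obtain ⟨x, hx, hxw⟩ := Nat.find_spec hex
  obtain ⟨i, hi⟩ := exists_Emin (H.exists_TT horb h hx)
  refine ⟨x, i, _, hi, ?_, hxw⟩
  by_contra hlt
  have h1 := hi.1.1
  refine Nat.find_min hex (m := Nat.find hex - i) (by omega) ⟨τ^[i] x, hi.1.2.2.2, ?_⟩
  rw [← Function.iterate_add_apply, Nat.sub_add_cancel (by omega), hxw]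

lemma Comb.unique (H : Comb τ c B) {x x' : V} {k k' j j' : ℕ} (h : Emin τ c B x k)
    (h' : Emin τ c B x' k') (hj : j < k) (hj' : j' < k') (he : τ^[j] x = τ^[j'] x') :
    x = x' ∧ k = k' ∧ j = j' := by
  have key : ∀ (x x' : V) (k k' j j' : ℕ), Emin τ c B x k → Emin τ c B x' k' → j < k → j' < k' →
      j ≤ j' → τ^[j] x = τ^[j'] x' → x = x' ∧ j = j' := by
    intro x x' k k' j j' h h' hj hj' hl he
    have h5 := H.cancel hl he
    rcases Nat.eq_zero_or_pos (j' - j) with h6 | h6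
    · rw [h6] at h5
      exact ⟨h5, by omega⟩
    · exact absurd (h5 ▸ h.1.2.2.1) (h'.2 (j' - j) h6 (by omega))
  have h1 : x = x' ∧ j = j' := by
    rcases le_total j j' with hl | hl
    · exact key x x' k k' j j' h h' hj hj' hl he
    · have := key x' x k' k j' j h' h hj' hj hl he.symm
      exact ⟨this.1.symm, this.2.symm⟩
  obtain ⟨rfl, rfl⟩ := h1
  refine ⟨rfl, ?_, rfl⟩
  rcases lt_trichotomy k k' with hl | hl | hl
  · exact absurd h.1.2.2.2 (h'.2 k h.1.1 hl)
  · exact hl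
  · exact absurd h'.1.2.2.2 (h.2 k' h'.1.1 hl)

/-- a relation extendable in both directions has a biinfinite path through every point -/
lemma exists_int_seq {α : Type} (r : α → α → Prop) (hf : ∀ a, ∃ b, r a b) (hb : ∀ b, ∃ a, r a b)
    (a : α) : ∃ x : ℤ → α, x 0 = a ∧ ∀ i, r (x i) (x (i + 1)) := by
  choose f hf using hf
  choose g hg using hb
  refine ⟨fun i => match i with
    | Int.ofNat n => f^[n] a
    | Int.negSucc n => g^[n + 1] a, rfl, ?_⟩
  rintro (n | n)
  · have : Int.ofNat n + 1 = Int.ofNat (n + 1) := rfl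
    rw [this]
    simp only [Function.iterate_succ_apply']
    exact hf _
  · rcases n with _ | n
    · have : Int.negSucc 0 + 1 = Int.ofNat 0 := rfl
      rw [this]
      exact hg _
    · have : Int.negSucc (n + 1) + 1 = Int.negSucc n := rfl
      rw [this]
      change r (g^[n + 1 + 1] a) _
      rw [Function.iterate_succ_apply' g (n + 1)]
      exact hg _

end PartF1

set_option linter.unusedSectionVars false
section PartG1
variable {R : Type u} [Ring R] [IsNakayama R]
variable {M N X : Type u} [AddCommGroup M] [Module R M] [AddCommGroup N] [Module R N]
  [AddCommGroup X] [Module R X]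
variable {V : Type} {P : V → ModuleCat.{u} R} {τ : V → V}

/-- lengths of the indecomposable projectives -/
noncomputable def cc (P : V → ModuleCat.{u} R) (v : V) : ℕ := len R (P v)

lemma not_proj_of_black (hP : Lab P) {v : V} (hb : Black P v) {K : Submodule R (P v)}
    (h0 : K ≠ ⊥) (h1 : len R K < len R (P v)) : ¬ Module.Projective R K := by
  intro hp
  have := (hP.us v).fin
  obtain ⟨N, hN⟩ := exists_len (R := R) (M := P v) (len R (P v) - 1) (by omega)
  exact hb N (by omega) (proj_of_sub_proj (hP.us v) ((hP.us v).le_iff.mpr (by omega)) h0 hp)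

lemma comb (hP : Lab P) (hτ : TauSpec P τ) : Comb τ (cc P) (Black P) := by
  refine ⟨tau_inj hP hτ, fun v => ?_, fun v k hb h0 h1 => ?_⟩
  · have := hτ.two v
    change 0 < len R (P v); omega
  · change k < len R (P v) at h1
    change len R (P v) < k + len R (P (τ^[k] v))
    have := (hP.us v).fin
    obtain ⟨K, hK⟩ := exists_len (R := R) (M := P v) (len R (P v) - k) (by omega)
    have hne : K ≠ ⊥ := ne_bot_of_len (by omega)
    have ht := tau_iter hP hτ (k := k) (hP.us v) (HasTop.self v) K hne (by omega)
    have hnp := not_proj_of_black hP hb hne (by omega)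
    by_contra hcon
    exact hnp (ht.proj_of_len hP (by omega))

/-- nonprojective retracts of syzygies, described by top and length -/
def RGp (P : V → ModuleCat.{u} R) (v : V) (k : ℕ) : Prop :=
  0 < k ∧ k < cc P v ∧ Black P v ∧ ∃ A : ModuleCat.{u} R, RG R A ∧ HasTop P v A ∧ len R A = k

lemma RGp.intro (hP : Lab P) {v : V} (hU : US R M) (hM : RG R M) (hv : HasTop P v M)
    (hnp : ¬ Module.Projective R M) : RGp P v (len R M) := by
  have := hU.fin
  have := hU.nt
  refine ⟨len_pos, ?_, hM.black hP hv hnp, ModuleCat.of R M, hM, hv, rfl⟩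
  by_contra hcon
  exact hnp (hv.proj_of_len hP (by change ¬ (len R M < len R (P v)) at hcon; omega))

lemma RGp.elim {v : V} {k : ℕ} (hP : Lab P) (h : RGp P v k) :
    ∃ A : ModuleCat.{u} R, RG R A ∧ HasTop P v A ∧ len R A = k ∧ US R A ∧
      ¬ Module.Projective R A := by
  obtain ⟨h0, h1, h2, A, hA, hv, hl⟩ := h
  change k < len R (P v) at h1
  have hA1 : Nontrivial A := by
    by_contra hcon
    rw [not_nontrivial_iff_subsingleton] at hcon
    have : len R A = 0 := by rw [len, Module.length_eq_zero]; rfl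
    omega
  refine ⟨A, hA, hv, hl, hv.us hP, fun hp => ?_⟩
  have := hv.len_of_proj hP hp
  omega

lemma RGp.fwd (hP : Lab P) (hτ : TauSpec P τ) {v : V} {k : ℕ} (h : RGp P v k) :
    RGp P (τ^[k] v) (cc P v - k) := by
  have hb := h.2.2.1
  have h0 := h.1
  have h1 : k < len R (P v) := h.2.1
  obtain ⟨A, hA, ⟨p, hp⟩, hl, hU, hnp⟩ := h.elim hP
  have := (hP.us v).fin
  have := hU.nt
  have hs := len_surj p hp
  have hne : LinearMap.ker p ≠ ⊥ := ne_bot_of_len (by omega)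
  have ht := tau_iter hP hτ (k := k) (hP.us v) (HasTop.self v) _ hne (by omega)
  have := RGp.intro hP ((hP.us v).sub hne) (hA.ker hP p hp) ht
    (not_proj_of_black hP hb hne (by omega))
  have he : len R (LinearMap.ker p) = cc P v - k := by
    change _ = len R (P v) - k; omega
  rwa [he] at this

lemma RGp.bwd (hP : Lab P) (hτ : TauSpec P τ) {v : V} {k : ℕ} (h : RGp P v k) :
    ∃ w m, RGp P w m ∧ τ^[m] w = v ∧ cc P w = m + k := by
  have h0 := h.1
  obtain ⟨A, hA, hv, hl, hU, hnp⟩ := h.elim hP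
  obtain ⟨w, K, hb, hK, ⟨e⟩, hq⟩ := hA.coker hP hU hnp
  have := (hP.us w).fin
  have hlK := len_congr e
  have hne : K ≠ ⊥ := ne_bot_of_len (by omega)
  have hlq := len_quot K
  have ht : HasTop P w (P w ⧸ K) := (HasTop.self w).surj K.mkQ K.mkQ_surjective
  have hqU := (hP.us w).quot hK
  have := hqU.nt
  have hnp : ¬ Module.Projective R (P w ⧸ K) := by
    intro hp
    have := ht.len_of_proj hP hp
    omega
  refine ⟨w, len R (P w ⧸ K), RGp.intro hP hqU hq ht hnp, ?_, ?_⟩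
  · have : Nontrivial K := Submodule.nontrivial_iff_ne_bot.mpr hne
    exact hP.top_unique (tau_iter hP hτ (hP.us w) (HasTop.self w) K hne (by omega)) (hv.congr e)
  · change len R (P w) = _; omega

lemma RGp.good (hP : Lab P) (hτ : TauSpec P τ) {v : V} {k : ℕ} (h : RGp P v k) :
    Good τ (cc P) (Black P) v := by
  refine ⟨{x | ∃ k, RGp P x k}, ⟨k, h⟩, ?_, ?_, ?_⟩
  · rintro x ⟨k, h⟩; exact h.2.2.1
  · rintro x ⟨k, h⟩
    have h1 := (h.fwd hP hτ).fwd hP hτ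
    rw [← Function.iterate_add_apply, Nat.sub_add_cancel h.2.1.le] at h1
    exact ⟨_, h1⟩
  · rintro x ⟨k, h⟩
    obtain ⟨w, m, hw, hwm, hc⟩ := h.bwd hP hτ
    obtain ⟨w', m', hw', hwm', hc'⟩ := hw.bwd hP hτ
    exact ⟨w', ⟨_, hw'⟩, by rw [hc', add_comm, Function.iterate_add_apply, hwm', hwm]⟩

lemma RGp.TT (hP : Lab P) (hτ : TauSpec P τ) {v : V} {k : ℕ} (h : RGp P v k) :
    TT τ (cc P) (Black P) v k :=
  ⟨h.1, h.2.1, h.good hP hτ, (h.fwd hP hτ).good hP hτ⟩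

lemma exists_hom_colen (hP : Lab P) (hτ : TauSpec P τ) (v : V) (k : ℕ) (hk : k < cc P v) :
    ∃ d : P (τ^[k] v) →ₗ[R] P v, len R (LinearMap.range d) + k = cc P v := by
  change k < len R (P v) at hk
  have := (hP.us v).fin
  obtain ⟨K, hK⟩ := exists_len (R := R) (M := P v) (len R (P v) - k) (by omega)
  have hne : K ≠ ⊥ := ne_bot_of_len (by omega)
  obtain ⟨p, hp⟩ := tau_iter hP hτ (k := k) (hP.us v) (HasTop.self v) K hne (by omega)
  refine ⟨K.subtype ∘ₗ p, ?_⟩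
  rw [LinearMap.range_comp, LinearMap.range_eq_top.mpr hp, Submodule.map_top, Submodule.range_subtype]
  change _ = len R (P v); omega

lemma gp_of_TT (hP : Lab P) (hτ : TauSpec P τ) {v : V} {k : ℕ} (h : TT τ (cc P) (Black P) v k)
    (hM : HasTop P v M) (hl : len R M = k) : IsGorensteinProjective R M := by
  have H := comb hP hτ
  obtain ⟨w, m, hw, hwm, hwc⟩ := H.bwd h
  let r : {p : V × ℕ // TT τ (cc P) (Black P) p.1 p.2} →
      {p : V × ℕ // TT τ (cc P) (Black P) p.1 p.2} → Prop :=
    fun p q => τ^[p.1.2] p.1.1 = q.1.1 ∧ cc P p.1.1 = p.1.2 + q.1.2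
  obtain ⟨x, hx0, hx⟩ := exists_int_seq r
    (by
      rintro ⟨⟨a, k⟩, h⟩
      refine ⟨⟨⟨_, _⟩, H.fwd h⟩, rfl, ?_⟩
      have := h.2.1
      change cc P a = k + (cc P a - k)
      dsimp only at this
      omega)
    (by
      rintro ⟨⟨a, k⟩, h⟩
      obtain ⟨w, m, hw, hwm, hwc⟩ := H.bwd h
      exact ⟨⟨⟨w, m⟩, hw⟩, hwm, hwc⟩) ⟨⟨w, m⟩, hw⟩
  have hd : ∀ i, ∃ d : P (x (i + 1)).1.1 →ₗ[R] P (x i).1.1,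
      len R (LinearMap.range d) = (x (i + 1)).1.2 := by
    intro i
    obtain ⟨h1, h2⟩ := hx i
    obtain ⟨d, hd⟩ := exists_hom_colen hP hτ (x i).1.1 (x i).1.2 (x i).2.2.1
    rw [← h1]
    exact ⟨d, by omega⟩
  choose d hd using hd
  have hex : ∀ i, LinearMap.range (d (i + 1)) = LinearMap.ker (d i) := by
    intro i
    apply (hP.us _).eq_of_len
    have := (hP.us (x (i + 1)).1.1).fin
    have h1 := len_ker_range (d i)
    have h2 := hd i
    have h3 := hd (i + 1)
    have h4 : len R (P (x (i + 1)).1.1) = _ := (hx (i + 1)).2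
    omega
  refine ⟨fun i => P (x i).1.1, d, fun i => hP.proj _, fun i => ?_, fun i φ hφ => ?_, ?_⟩
  · exact LinearMap.exact_iff.mpr (hex i).symm
  · have hle : LinearMap.ker (d i) ≤ LinearMap.ker φ := by
      rw [← hex]
      rintro _ ⟨y, rfl⟩
      exact congrArg (fun g => g y) hφ
    obtain ⟨ψ, hψ⟩ := ext_black_proj hP (x i).2.2.2.1.black (X := R) inferInstance
      (LinearMap.range (d i)) ((LinearMap.ker (d i)).liftQ φ hle ∘ₗ
        (d i).quotKerEquivRange.symm.toLinearMap)
    refine ⟨ψ, ?_⟩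
    ext y
    have h1 := hψ ⟨d i y, y, rfl⟩
    change ψ (d i y) = _
    refine h1.trans ?_
    have h2 : (d i).quotKerEquivRange.symm ⟨d i y, y, rfl⟩ = (LinearMap.ker (d i)).mkQ y := by
      rw [LinearEquiv.symm_apply_eq]
      exact Subtype.ext rfl
    change (LinearMap.ker (d i)).liftQ φ hle ((d i).quotKerEquivRange.symm ⟨d i y, y, rfl⟩) = φ y
    rw [h2]
    exact Submodule.liftQ_apply _ _ _
  · have h1 := hx 0
    rw [hx0] at h1
    obtain ⟨h2, h3⟩ := h1
    dsimp only at h2 h3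
    refine hM.iso hP (v := v) ?_ ?_
    · have : (x (0 + 1)).1.1 = v := by rw [← h2, hwm]
      rw [← this]
      exact ⟨(d 0).rangeRestrict, (d 0).surjective_rangeRestrict⟩
    · rw [hd 0]; omega

end PartG1

set_option linter.unusedSectionVars false
section PartH1
variable {R : Type u} [Ring R] [IsNakayama R]
variable {M N X : Type u} [AddCommGroup M] [Module R M] [AddCommGroup N] [Module R N]
  [AddCommGroup X] [Module R X]
variable {V : Type} {P : V → ModuleCat.{u} R} {τ : V → V}

lemma proj_of_pi {ι : Type} [Fintype ι] (W : ι → ModuleCat.{u} R) (e : M ≃ₗ[R] (Π i, W i))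
    (h : ∀ i, Module.Projective R (W i)) : Module.Projective R M := by
  classical
  exact Module.Projective.of_equiv
    ((DFinsupp.linearEquivFunOnFintype (R := R) (M := fun i => (W i : Type u))).trans e.symm)

lemma rg_factor {ι : Type} [Fintype ι] (W : ι → ModuleCat.{u} R) (e : M ≃ₗ[R] (Π i, W i))
    (h : IsGorensteinProjective R M) (i : ι) : RG R (W i) := by
  classical
  exact RG.of_gp h (e.symm.toLinearMap ∘ₗ LinearMap.single R (fun i => (W i : Type u)) i)
    (LinearMap.proj i ∘ₗ e.toLinearMap) (fun a => by simp)

lemma exists_TT_of_core (hP : Lab P) (hτ : TauSpec P τ) [Module.Finite R M]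
    (h : IsGorensteinProjective R M) (hnp : ¬ Module.Projective R M) :
    ∃ v k, TT τ (cc P) (Black P) v k := by
  obtain ⟨ι, _, W, hW, ⟨e⟩⟩ := exists_decomp (R := R) M
  by_contra hcon
  refine hnp (proj_of_pi W e fun i => ?_)
  by_contra hi
  obtain ⟨v, hv⟩ := hP.cover (hW i)
  exact hcon ⟨v, _, (RGp.intro hP (hW i) (rg_factor W e h i) hv hi).TT hP hτ⟩

lemma elem_Emin (hP : Lab P) (hτ : TauSpec P τ) (h : IsElementary R M) :
    US R M ∧ ∃ v, HasTop P v M ∧ Emin τ (cc P) (Black P) v (len R M) := by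
  classical
  obtain ⟨hnt, hlen, hgp, hnp, hq⟩ := h
  have := finite_of_hasLength hlen
  have hU : US R M := by
    obtain ⟨ι, _, W, hW, ⟨e⟩⟩ := exists_decomp (R := R) M
    have hne : Nonempty ι := by
      by_contra hcon
      rw [not_nonempty_iff] at hcon
      have : Subsingleton M := e.toEquiv.subsingleton
      exact not_subsingleton M this
    obtain ⟨i⟩ := hne
    have hWgp : IsGorensteinProjective R (W i) := by
      by_cases hp : Module.Projective R (W i)
      · exact GP.of_proj hp
      · obtain ⟨v, hv⟩ := hP.cover (hW i)
        exact gp_of_TT hP hτ ((RGp.intro hP (hW i) (rg_factor W e hgp i) hv hp).TT hP hτ) hv rfl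
    let q : M →ₗ[R] W i := LinearMap.proj i ∘ₗ e.toLinearMap
    have hqs : Function.Surjective q := (LinearMap.proj_surjective (R := R) (φ := fun i => (W i : Type u)) i).comp e.surjective
    have := (hW i).nt
    have hk : LinearMap.ker q = ⊥ := by
      by_contra hk
      refine hq (LinearMap.ker q) hk ?_ (GP.congr hWgp (q.quotKerEquivOfSurjective hqs).symm)
      intro ht
      obtain ⟨y, hy⟩ := exists_ne (0 : W i)
      obtain ⟨z, rfl⟩ := hqs y
      exact hy (by
        have : z ∈ LinearMap.ker q := by rw [ht]; trivial
        exact this)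
    exact (hW i).congr (LinearEquiv.ofBijective q ⟨LinearMap.ker_eq_bot.mp hk, hqs⟩).symm
  refine ⟨hU, ?_⟩
  obtain ⟨v, hv⟩ := hP.cover hU
  have hT := (RGp.intro hP hU (RG.of_gp hgp LinearMap.id LinearMap.id (fun _ => rfl)) hv hnp).TT hP hτ
  refine ⟨v, hv, hT, fun j hj0 hj hg => ?_⟩
  obtain ⟨K, hK⟩ := exists_len (R := R) (M := M) (len R M - j) (by omega)
  have hl := len_quot K
  refine hq K (ne_bot_of_len (by omega)) (ne_top_of_len (by omega)) ?_
  exact gp_of_TT hP hτ ⟨hj0, hj.trans hT.2.1, hT.2.2.1, hg⟩ (hv.surj K.mkQ K.mkQ_surjective)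
    (by omega)

lemma Emin_elem (hP : Lab P) (hτ : TauSpec P τ) {v : V} {k : ℕ}
    (h : Emin τ (cc P) (Black P) v k) :
    ∃ E : ModuleCat.{u} R, IsElementary R E ∧ HasTop P v E ∧ len R E = k := by
  obtain ⟨hT, hmin⟩ := h
  have h0 := hT.1
  have h1 : k < len R (P v) := hT.2.1
  have := (hP.us v).fin
  obtain ⟨K, hK⟩ := exists_len (R := R) (M := P v) (len R (P v) - k) (by omega)
  have hl := len_quot K
  have hU := (hP.us v).quot (K := K) (ne_top_of_len (by omega))
  have hv : HasTop P v (P v ⧸ K) := (HasTop.self v).surj K.mkQ K.mkQ_surjective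
  have hnt := hU.nt
  have hlk : len R (P v ⧸ K) = k := by omega
  refine ⟨ModuleCat.of R (P v ⧸ K), ⟨hU.nt, hasLength_of_finite (R := R) (M := P v ⧸ K),
    gp_of_TT hP hτ hT hv hlk, ?_, ?_⟩, hv, by change len R (P v ⧸ K) = k; omega⟩
  · intro hp
    have h2 : len R (P v) = len R (P v ⧸ K) := hv.len_of_proj hP hp
    omega
  · intro N hN hN' hgp
    change Submodule R (P v ⧸ K) at N
    have hl2 := len_quot N
    have hp1 := len_sub_pos hN
    have hUq := hU.quot hN'
    have hvq := hv.surj N.mkQ N.mkQ_surjective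
    have := hUq.nt
    have hp2 := len_pos (R := R) (M := (P v ⧸ K) ⧸ N)
    have hnp : ¬ Module.Projective R ((P v ⧸ K) ⧸ N) := by
      intro hp
      have := hvq.len_of_proj hP hp
      omega
    have hR := RGp.intro hP hUq (RG.of_gp hgp LinearMap.id LinearMap.id (fun _ => rfl)) hvq hnp
    exact hmin _ hp2 (by omega) ((hR.fwd hP hτ).good hP hτ)

lemma mult_eq (hP : Lab P) (hτ : TauSpec P τ) (hU : US R M) {x w : V} (hx : HasTop P x M)
    (hN : IsSimpleModule R N) (hw : HasTop P w N) {m : ℕ} (h : MultiplicityOf R N M m) :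
    m = Nat.card {j : Fin (len R M) // τ^[len R M - 1 - j] x = w} := by
  obtain ⟨n, c, hc0, hc1, hc2, hm⟩ := h
  have := hU.fin
  have hs : ∀ i : Fin n, IsSimpleModule R (↥(c i.succ) ⧸ (c i.castSucc).comap (c i.succ).subtype) :=
    fun i => (covBy_iff_quot_is_simple (hc2 i).le).mp (hc2 i)
  have hlen : ∀ j : Fin (n + 1), len R (c j) = j := by
    intro j
    induction j using Fin.induction with
    | zero => rw [hc0, len_bot]; rfl
    | succ i ih =>
      have h1 := len_quot ((c i.castSucc).comap (c i.succ).subtype)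
      rw [len_comap (hc2 i).le, len_simple (hs i), ih] at h1
      rw [← h1]; simp
  have hn : len R M = n := by
    have := hlen (Fin.last n)
    rw [hc1, len_congr Submodule.topEquiv] at this
    simpa using this
  rw [hm]
  rw [hn]
  apply Nat.card_congr
  refine Equiv.subtypeEquivRight fun i => ?_
  have hl := hlen i.succ
  rw [Fin.val_succ] at hl
  have hi := i.2
  have hne : c i.succ ≠ ⊥ := ne_bot_of_len (by omega)
  have ht := tau_iter hP hτ (k := n - 1 - i) hU hx (c i.succ) hne (by omega)
  have htq := ht.surj ((c i.castSucc).comap (c i.succ).subtype).mkQ (Submodule.mkQ_surjective _)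
  have := hs i
  have := IsSimpleModule.nontrivial R N
  constructor
  · rintro ⟨e⟩
    exact hP.top_unique (htq.congr e) hw
  · intro h
    rw [h] at htq
    exact htq.iso hP hw (by rw [len_simple (hs i), len_simple hN])

end PartH1

section MainAux
variable {R : Type u} [Ring R] [IsNakayama R]

lemma main_aux (h0 : NoSimpleProjectives R) (hconn : IsConnectedAlg R)
    (hcore : ∃ M : ModuleCat.{u} R, (∃ n, HasLength R M n) ∧
      IsGorensteinProjective R M ∧ ¬ Module.Projective R M)
    (g : ℕ) (E : Fin g → ModuleCat.{u} R)
    (hE : ∀ i, IsElementary R (E i))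
    (hpair : ∀ i j, i ≠ j → IsEmpty ((E i : Type u) ≃ₗ[R] (E j : Type u)))
    (hall : ∀ (X : Type u) [AddCommGroup X] [Module R X], IsElementary R X →
      ∃ i, Nonempty (X ≃ₗ[R] (E i : Type u)))
    (S : Type u) [AddCommGroup S] [Module R S] (hS : IsSimpleModule R S)
    (m : Fin g → ℕ) (hm : ∀ i, MultiplicityOf R S (E i) (m i)) : ∑ i, m i = 1 := by
  obtain ⟨V, _, P, hP⟩ := exists_lab (R := R)
  obtain ⟨τ, hτ⟩ := exists_tau hP h0
  have H := comb hP hτ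
  have horb := tau_orbit hP hτ hconn
  obtain ⟨a, k, hT⟩ : ∃ a k, TT τ (cc P) (Black P) a k := by
    obtain ⟨M, hl, hgp, hnp⟩ := hcore
    have := finite_of_hasLength hl
    exact exists_TT_of_core hP hτ hgp hnp
  obtain ⟨w, hw⟩ := hP.cover (US.simple hS)
  have hEU := fun i => (elem_Emin hP hτ (hE i)).1
  choose x hx hmin using fun i => (elem_Emin hP hτ (hE i)).2
  have hmi := fun i => mult_eq hP hτ (hEU i) (hx i) hS hw (hm i)
  rw [Finset.sum_congr rfl (fun i _ => hmi i), ← Nat.card_sigma, Nat.card_eq_one_iff_unique]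
  constructor
  · constructor
    rintro ⟨i, ⟨j, hj⟩, h⟩ ⟨i', ⟨j', hj'⟩, h'⟩
    dsimp only at h h'
    obtain ⟨h1, h2, h3⟩ := H.unique (hmin i) (hmin i') (by omega) (by omega) (h.trans h'.symm)
    have hii : i = i' := by
      by_contra hne
      have hx' := hx i'
      rw [← h1] at hx'
      obtain ⟨e⟩ := (hx i).iso hP hx' h2
      exact (hpair i i' hne).false e
    subst hii
    have : j = j' := by omega
    subst this
    rfl
  · obtain ⟨y, i, N, hy, hN, hyw⟩ := H.exists_pos horb hT w
    obtain ⟨X, hX, hXy, hXl⟩ := Emin_elem hP hτ hy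
    obtain ⟨i0, ⟨e⟩⟩ := hall X hX
    have hle := len_congr e
    have := (hEU i0).nt
    have hxy : x i0 = y := hP.top_unique (hx i0) (hXy.congr e)
    refine ⟨⟨i0, ⟨i - 1 - N, by omega⟩, ?_⟩⟩
    dsimp only
    rw [hxy, ← hle, hXl]
    have : i - 1 - (i - 1 - N) = N := by omega
    rw [this, hyw]

end MainAux

/-- Let `Λ` be a connected Nakayama algebra (without simple projectives) whose Gorenstein
core is nonzero, and let `E 0, …, E (g-1)` be representatives of the isomorphism classes
of elementary Gorenstein projective modules. Then every simple `Λ`-module occurs with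
multiplicity exactly `1` as a composition factor of `E 0 ⊕ ⋯ ⊕ E (g-1)`. -/
theorem simple_multiplicity_one_in_elementaries [IsNakayama Λ]
    (h0 : NoSimpleProjectives Λ) (hconn : IsConnectedAlg Λ)
    (hcore : ∃ M : ModuleCat.{u} Λ, (∃ n, HasLength Λ M n) ∧
      IsGorensteinProjective Λ M ∧ ¬ Module.Projective Λ M)
    (g : ℕ) (E : Fin g → ModuleCat.{u} Λ)
    (hE : ∀ i, IsElementary Λ (E i))
    (hpair : ∀ i j, i ≠ j → IsEmpty ((E i : Type u) ≃ₗ[Λ] (E j : Type u)))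
    (hall : ∀ (X : Type u) [AddCommGroup X] [Module Λ X], IsElementary Λ X →
      ∃ i, Nonempty (X ≃ₗ[Λ] (E i : Type u))) :
    ∀ (S : Type u) [AddCommGroup S] [Module Λ S], IsSimpleModule Λ S →
      ∀ m : Fin g → ℕ, (∀ i, MultiplicityOf Λ S (E i) (m i)) → ∑ i, m i = 1 := by
  exact fun S _ _ hS m hm => main_aux h0 hconn hcore g E hE hpair hall S hS m hm
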